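/- arXiv:1311.4685 — 4 statements merged into one kernel-verified Lean document; each statement's English description precedes it below -/
import Mathlib

section
/- For every integer n ≥ 3, every p ≥ 1 and every infinite-dimensional Banach space X over 𝕂 (𝕂 = ℝ or ℂ), there exists a continuous n-linear operator T : X × ⋯ × X → 𝕂 that fails to be factorable p-dominated. -/
open scoped BigOperators
open MeasureTheory

noncomputable section

section Defs

variable (𝕜 : Type*) [RCLike 𝕜]

section Multi

variable {n : ℕ} {X : Fin n → Type*} {Y : Type*}
  [∀ k, NormedAddCommGroup (X k)] [∀ k, NormedSpace 𝕜 (X k)]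
  [NormedAddCommGroup Y] [NormedSpace 𝕜 Y]

/-- `C` witnesses the defining inequality of factorable strongly `p`-summing
multilinear operators. -/
def FactStronglySummingBound (p : ℝ) (T : ContinuousMultilinearMap 𝕜 X Y) (C : ℝ) : Prop :=
  0 ≤ C ∧ ∀ (m₁ m₂ : ℕ) (x : Fin m₁ → Fin m₂ → (∀ k, X k)) (lam : Fin m₁ → Fin m₂ → 𝕜),
    (∑ j, ‖∑ i, lam j i • T (x j i)‖ ^ p) ^ (1 / p) ≤
      C * ⨆ φ : {φ : ContinuousMultilinearMap 𝕜 X 𝕜 // ‖φ‖ ≤ 1},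
        (∑ j, ‖∑ i, lam j i • φ.1 (x j i)‖ ^ p) ^ (1 / p)

/-- Factorable strongly `p`-summing continuous multilinear operators. -/
def FactStronglySumming (p : ℝ) (T : ContinuousMultilinearMap 𝕜 X Y) : Prop :=
  ∃ C, FactStronglySummingBound 𝕜 p T C

/-- The factorable strongly `p`-summing norm `‖T‖_{FSt,p}` (the least admissible constant). -/
def fstMultiNorm (p : ℝ) (T : ContinuousMultilinearMap 𝕜 X Y) : ℝ :=
  sInf {C | FactStronglySummingBound 𝕜 p T C}

/-- Strongly `p`-summing continuous multilinear operators (Dimant). -/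
def StronglySumming (p : ℝ) (T : ContinuousMultilinearMap 𝕜 X Y) : Prop :=
  ∃ C : ℝ, 0 ≤ C ∧ ∀ (m : ℕ) (x : Fin m → (∀ k, X k)),
    (∑ j, ‖T (x j)‖ ^ p) ^ (1 / p) ≤
      C * ⨆ φ : {φ : ContinuousMultilinearMap 𝕜 X 𝕜 // ‖φ‖ ≤ 1},
        (∑ j, ‖φ.1 (x j)‖ ^ p) ^ (1 / p)

/-- Factorable `p`-dominated continuous multilinear operators. -/
def FactorablePDominated (p : ℝ) (T : ContinuousMultilinearMap 𝕜 X Y) : Prop :=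
  ∃ C : ℝ, 0 ≤ C ∧ ∀ (m₁ m₂ : ℕ) (x : Fin m₁ → Fin m₂ → (∀ k, X k))
    (lam : Fin m₁ → Fin m₂ → 𝕜),
    (∑ j, ‖∑ i, lam j i • T (x j i)‖ ^ p) ^ (1 / p) ≤
      C * ⨆ φ : ∀ k, {f : X k →L[𝕜] 𝕜 // ‖f‖ ≤ 1},
        (∑ j, ‖∑ i, lam j i • ∏ k, (φ k).1 (x j i k)‖ ^ p) ^ (1 / p)

/-- `p`-semi-integral continuous multilinear operators. -/
def PSemiIntegral (p : ℝ) (T : ContinuousMultilinearMap 𝕜 X Y) : Prop :=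
  ∃ C : ℝ, 0 ≤ C ∧ ∀ (m : ℕ) (x : Fin m → (∀ k, X k)),
    (∑ j, ‖T (x j)‖ ^ p) ^ (1 / p) ≤
      C * ⨆ φ : ∀ k, {f : X k →L[𝕜] 𝕜 // ‖f‖ ≤ 1},
        (∑ j, ‖∏ k, (φ k).1 (x j k)‖ ^ p) ^ (1 / p)

end Multi

section Poly

variable {X Y : Type*} [NormedAddCommGroup X] [NormedSpace 𝕜 X]
  [NormedAddCommGroup Y] [NormedSpace 𝕜 Y]

/-- `P` is a continuous `m`-homogeneous polynomial: the diagonal of a continuous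
`m`-linear map. -/
def IsHomogPoly (m : ℕ) (P : X → Y) : Prop :=
  ∃ T : ContinuousMultilinearMap 𝕜 (fun _ : Fin m => X) Y, ∀ x, P x = T (fun _ => x)

/-- Sup norm of a (homogeneous polynomial) map on the closed unit ball. -/
def polyNorm (P : X → Y) : ℝ :=
  ⨆ x : {x : X // ‖x‖ ≤ 1}, ‖P x.1‖

/-- `C` witnesses the defining inequality of factorable strongly `p`-summing
`m`-homogeneous polynomials. -/
def FactStronglySummingPolyBound (m : ℕ) (p : ℝ) (P : X → Y) (C : ℝ) : Prop :=
  0 ≤ C ∧ ∀ (m₁ m₂ : ℕ) (x : Fin m₁ → Fin m₂ → X) (lam : Fin m₁ → Fin m₂ → 𝕜),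
    (∑ j, ‖∑ i, lam j i • P (x j i)‖ ^ p) ^ (1 / p) ≤
      C * ⨆ q : {q : X → 𝕜 // IsHomogPoly 𝕜 m q ∧ polyNorm q ≤ 1},
        (∑ j, ‖∑ i, lam j i • q.1 (x j i)‖ ^ p) ^ (1 / p)

/-- Factorable strongly `p`-summing `m`-homogeneous polynomials. -/
def FactStronglySummingPoly (m : ℕ) (p : ℝ) (P : X → Y) : Prop :=
  IsHomogPoly 𝕜 m P ∧ ∃ C, FactStronglySummingPolyBound 𝕜 m p P C

/-- The factorable strongly `p`-summing norm `‖P‖_{FSt,p}` of a polynomial. -/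
def fstPolyNorm (m : ℕ) (p : ℝ) (P : X → Y) : ℝ :=
  sInf {C | FactStronglySummingPolyBound 𝕜 m p P C}

/-- `C` witnesses the defining inequality of absolutely `p`-summing linear operators. -/
def AbsSummingBound (p : ℝ) (u : X →L[𝕜] Y) (C : ℝ) : Prop :=
  0 ≤ C ∧ ∀ (m : ℕ) (x : Fin m → X),
    (∑ j, ‖u (x j)‖ ^ p) ^ (1 / p) ≤
      C * ⨆ φ : {φ : X →L[𝕜] 𝕜 // ‖φ‖ ≤ 1}, (∑ j, ‖φ.1 (x j)‖ ^ p) ^ (1 / p)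

/-- Absolutely `p`-summing continuous linear operators. -/
def AbsolutelySumming (p : ℝ) (u : X →L[𝕜] Y) : Prop :=
  ∃ C, AbsSummingBound 𝕜 p u C

/-- The absolutely `p`-summing norm `π_p(u)` (the least admissible constant). -/
def piSummingNorm (p : ℝ) (u : X →L[𝕜] Y) : ℝ :=
  sInf {C | AbsSummingBound 𝕜 p u C}

end Poly

end Defs

end

lemma dr_det {𝕜 H : Type*} [RCLike 𝕜] [NormedAddCommGroup H] [InnerProductSpace 𝕜 H]
    [FiniteDimensional 𝕜 H] (K : Submodule 𝕜 H) (t : 𝕜) :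
    LinearMap.det (LinearMap.id + t • (K.starProjection : H →ₗ[𝕜] H)) =
      (1 + t) ^ Module.finrank 𝕜 K := by
  let e := K.prodEquivOfIsCompl _ K.isCompl_orthogonal
  let b := (Module.finBasis 𝕜 K).prod (Module.finBasis 𝕜 Kᗮ)
  have h1 : ∀ x : K, K.starProjection (x : H) = x := fun x =>
    Submodule.starProjection_eq_self_iff.2 x.2
  have h2 : ∀ x : Kᗮ, K.starProjection (x : H) = 0 := fun x =>
    (Submodule.starProjection_apply_eq_zero_iff K).2 x.2
  have : (e.symm : H →ₗ[𝕜] _) ∘ₗ (LinearMap.id + t • (K.starProjection : H →ₗ[𝕜] H)) ∘ₗ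
        (e.symm.symm : (K × Kᗮ) →ₗ[𝕜] H) = LinearMap.prodMap ((1 + t) • LinearMap.id) LinearMap.id := by
    apply LinearMap.ext
    rintro ⟨x, y⟩
    apply e.injective
    simp [e, h1, h2, add_smul]
  rw [← LinearMap.det_conj _ e.symm, this, LinearMap.det_prodMap]
  simp

lemma dr_scalar (k N : ℕ) (c : ℝ) (hc : 0 ≤ c)
    (h : ∀ t : ℝ, 0 < t → (1 + t) ^ k ≤ (1 + t * c) ^ N) : (k : ℝ) ≤ N * c := by
  by_contra hlt
  push Not at hlt
  set s := (N : ℝ) * c with hs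
  have hs0 : 0 ≤ s := by positivity
  have key : ∀ t : ℝ, 0 < t → t * s ≤ 1 → (k : ℝ) ≤ s + s ^ 2 * t := by
    intro t ht hts
    have h1 : 1 + (k : ℝ) * t ≤ (1 + t) ^ k := one_add_mul_le_pow (by linarith) k
    have h2 : (1 + t * c) ^ N ≤ Real.exp (t * s) := by
      calc (1 + t * c) ^ N ≤ (Real.exp (t * c)) ^ N := by
            have := Real.add_one_le_exp (t * c)
            gcongr
            linarith
        _ = Real.exp (t * s) := by rw [← Real.exp_nat_mul]; congr 1; rw [hs]; ring
    have h3 : Real.exp (t * s) ≤ 1 + t * s + (t * s) ^ 2 := by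
      have := Real.abs_exp_sub_one_sub_id_le (x := t * s) (by rw [abs_of_nonneg (by positivity)]; exact hts)
      have := (abs_le.1 this).2
      linarith
    have h4 := h t ht
    have : (k : ℝ) * t ≤ (s + s ^ 2 * t) * t := by nlinarith
    exact le_of_mul_le_mul_right this ht
  set d := (k : ℝ) - s
  have hd : 0 < d := by simp only [d]; linarith
  set t := min (1 / (1 + s)) (d / (2 * (1 + s ^ 2))) with ht
  have ht0 : 0 < t := by positivity
  have h1 : t * s ≤ 1 := by
    have : t * (1 + s) ≤ 1 := by
      rw [← le_div_iff₀ (by positivity)]; exact min_le_left _ _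
    nlinarith
  have h2 : t * (2 * (1 + s ^ 2)) ≤ d := by
    rw [← le_div_iff₀ (by positivity)]; exact min_le_right _ _
  have := key t ht0 h1
  have : d ≤ s ^ 2 * t := by simp only [d]; linarith
  nlinarith

/-- Maximal-volume position. -/
lemma dr_max {𝕜 W : Type*} [RCLike 𝕜] [NormedAddCommGroup W] [NormedSpace 𝕜 W]
    [FiniteDimensional 𝕜 W] (N : ℕ) (hN : Module.finrank 𝕜 W = N) :
    ∃ u : EuclideanSpace 𝕜 (Fin N) →L[𝕜] W, ‖u‖ ≤ 1 ∧
      ∀ (K : Submodule 𝕜 (EuclideanSpace 𝕜 (Fin N))) (c : ℝ), 0 ≤ c →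
        (∀ x ∈ K, ‖u x‖ ≤ c * ‖x‖) → (Module.finrank 𝕜 K : ℝ) ≤ N * c := by
  set H := EuclideanSpace 𝕜 (Fin N)
  have e : W ≃L[𝕜] H := ContinuousLinearEquiv.ofFinrankEq (by simp [H, hN])
  have hfd : FiniteDimensional 𝕜 (H →L[𝕜] W) := inferInstance
  have hpr : ProperSpace (H →L[𝕜] W) := FiniteDimensional.proper 𝕜 _
  let F : (H →L[𝕜] W) → ℝ := fun u => ‖((e : W →L[𝕜] H) ∘L u).det‖
  have hF : Continuous F := by
    refine continuous_norm.comp (ContinuousLinearMap.continuous_det.comp ?_)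
    exact (ContinuousLinearMap.compL 𝕜 H W H (e : W →L[𝕜] H)).continuous
  obtain ⟨u, hu, hmax⟩ := (isCompact_closedBall (0 : H →L[𝕜] W) 1).exists_isMaxOn
    ⟨0, by simp⟩ hF.continuousOn
  have hu1 : ‖u‖ ≤ 1 := by simpa using hu
  have hscale : ∀ (v : H →L[𝕜] W) (r : ℝ), 0 < r → ‖v‖ ≤ r → F v ≤ r ^ N * F u := by
    intro v r hr hv
    have h1 : F (((r⁻¹ : ℝ) : 𝕜) • v) ≤ F u := by
      apply hmax
      simp only [Metric.mem_closedBall, dist_zero_right, norm_smul, RCLike.norm_ofReal]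
      rw [abs_of_pos (by positivity), inv_mul_le_iff₀ hr]
      simpa using hv
    have h2 : F (((r⁻¹ : ℝ) : 𝕜) • v) = (r⁻¹) ^ N * F v := by
      simp only [F, ContinuousLinearMap.det]
      rw [ContinuousLinearMap.comp_smul, ContinuousLinearMap.toLinearMap_smul, LinearMap.det_smul]
      simp [H, abs_of_pos hr]
    rw [h2, inv_pow, inv_mul_le_iff₀ (by positivity)] at h1
    exact h1
  have hpos : 0 < F u := by
    have h1 := hscale (e.symm : H →L[𝕜] W) (‖(e.symm : H →L[𝕜] W)‖ + 1) (by positivity) (by linarith)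
    have h2 : F (e.symm : H →L[𝕜] W) = 1 := by
      simp [F, ContinuousLinearMap.det]
    rw [h2] at h1
    by_contra h0
    have h0 : F u = 0 := le_antisymm (not_lt.1 h0) (norm_nonneg _)
    rw [h0] at h1
    norm_num at h1
  refine ⟨u, hu1, fun K c hc hK => dr_scalar _ _ _ hc fun t ht => ?_⟩
  have hP : ‖u ∘L K.starProjection‖ ≤ c := by
    refine ContinuousLinearMap.opNorm_le_bound _ hc fun x => ?_
    refine (hK _ (Submodule.starProjection_apply_mem K x)).trans ?_
    gcongr
    exact Submodule.norm_starProjection_apply_le K x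
  have h1 := hscale (u ∘L (ContinuousLinearMap.id 𝕜 H + (t : 𝕜) • K.starProjection)) (1 + t * c)
    (by positivity) (by
      rw [ContinuousLinearMap.comp_add, ContinuousLinearMap.comp_smul]
      refine (norm_add_le _ _).trans ?_
      rw [norm_smul, RCLike.norm_ofReal, abs_of_pos ht]
      gcongr
      simpa using hu1)
  have h2 : F (u ∘L (ContinuousLinearMap.id 𝕜 H + (t : 𝕜) • K.starProjection)) =
      (1 + t) ^ Module.finrank 𝕜 K * F u := by
    simp only [F, ContinuousLinearMap.det]
    rw [← ContinuousLinearMap.comp_assoc, ContinuousLinearMap.toLinearMap_comp, LinearMap.det_comp, norm_mul, mul_comm]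
    congr 1
    rw [ContinuousLinearMap.toLinearMap_add, ContinuousLinearMap.toLinearMap_smul, ContinuousLinearMap.coe_id, dr_det]
    rw [norm_pow]
    congr 1
    rw [show (1 : 𝕜) + (t : 𝕜) = ((1 + t : ℝ) : 𝕜) by push_cast; rfl, RCLike.norm_ofReal, abs_of_pos (by positivity)]
  rw [h2] at h1
  exact le_of_mul_le_mul_right h1 hpos

lemma dr_family {𝕜 W : Type*} [RCLike 𝕜] [NormedAddCommGroup W] [NormedSpace 𝕜 W]
    [FiniteDimensional 𝕜 W] (m : ℕ) (hN : Module.finrank 𝕜 W = 2 * m) :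
    ∃ x : Fin m → W, (∀ i, 1 / 2 ≤ ‖x i‖) ∧
      ∀ a : Fin m → 𝕜, ‖∑ i, a i • x i‖ ^ 2 ≤ ∑ i, ‖a i‖ ^ 2 := by
  obtain ⟨u, hu, hK⟩ := dr_max (𝕜 := 𝕜) (W := W) (2 * m) hN
  have key : ∀ k : ℕ, k ≤ m → ∃ y : Fin k → EuclideanSpace 𝕜 (Fin (2 * m)),
      Orthonormal 𝕜 y ∧ ∀ i, 1 / 2 ≤ ‖u (y i)‖ := by
    intro k
    induction k with
    | zero => exact fun _ => ⟨Fin.elim0, ⟨fun i => i.elim0, fun i => i.elim0⟩, fun i => i.elim0⟩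
    | succ k ih =>
      intro hk
      obtain ⟨y, hy, hy2⟩ := ih (by omega)
      set S := Submodule.span 𝕜 (Set.range y) with hS
      have hdim : Module.finrank 𝕜 S = k := by
        rw [finrank_span_eq_card hy.linearIndependent]; simp
      have hdim2 : Module.finrank 𝕜 Sᗮ = 2 * m - k := by
        have := Submodule.finrank_add_finrank_orthogonal S
        simp only [finrank_euclideanSpace, Fintype.card_fin] at this
        omega
      have : ∃ x ∈ Sᗮ, 1 / 2 * ‖x‖ < ‖u x‖ := by
        by_contra hcon
        push Not at hcon
        have h := hK Sᗮ (1 / 2) (by norm_num) hcon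
        rw [hdim2, Nat.cast_sub (by omega)] at h
        push_cast at h
        have : ((k + 1 : ℕ) : ℝ) ≤ m := by exact_mod_cast hk
        push_cast at this
        linarith
      obtain ⟨x, hx, hxu⟩ := this
      have hx0 : x ≠ 0 := by rintro rfl; simp at hxu
      have hxn : 0 < ‖x‖ := norm_pos_iff.2 hx0
      refine ⟨Fin.snoc (α := fun _ => EuclideanSpace 𝕜 (Fin (2 * m))) y (((‖x‖⁻¹ : ℝ) : 𝕜) • x), ?_, ?_⟩
      · have horth : ∀ i, inner 𝕜 (y i) x = 0 := fun i =>
          (Submodule.mem_orthogonal S x).1 hx _ (Submodule.subset_span ⟨i, rfl⟩)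
        have horth' : ∀ i, inner 𝕜 x (y i) = 0 := fun i => inner_eq_zero_symm.1 (horth i)
        constructor
        · intro i
          refine Fin.lastCases ?_ (fun i => ?_) i
          · simp [norm_smul, hxn.ne']
          · simpa using hy.1 i
        · intro i j
          refine Fin.lastCases ?_ (fun i => ?_) i <;> refine Fin.lastCases ?_ (fun j => ?_) j
          · intro h; exact absurd rfl h
          · intro _; simp [inner_smul_left, horth']
          · intro _; simp [inner_smul_right, horth]
          · intro h
            simpa using hy.2 (fun h' => h (by rw [h']))
      · intro i
        refine Fin.lastCases ?_ (fun i => ?_) i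
        · simp only [Fin.snoc_last, map_smul, norm_smul, RCLike.norm_ofReal]
          rw [abs_of_pos (by positivity), ← div_eq_inv_mul, le_div_iff₀ hxn]
          exact hxu.le
        · simpa using hy2 i
  obtain ⟨y, hy, hy2⟩ := key m le_rfl
  refine ⟨fun i => u (y i), hy2, fun a => ?_⟩
  have h1 : ∑ i, a i • u (y i) = u (∑ i, a i • y i) := by simp
  have h2 : ‖∑ i, a i • y i‖ ^ 2 = ∑ i, ‖a i‖ ^ 2 := by
    have := Orthonormal.inner_sum hy a a Finset.univ
    rw [inner_self_eq_norm_sq_to_K] at this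
    simp only [RCLike.conj_mul] at this
    exact_mod_cast this
  rw [h1, ← h2]
  gcongr
  simpa using u.le_of_opNorm_le hu (∑ i, a i • y i)

lemma dvoretzky_rogers {𝕜 E : Type*} [RCLike 𝕜] [NormedAddCommGroup E] [NormedSpace 𝕜 E]
    (hE : ¬ FiniteDimensional 𝕜 E) (m : ℕ) :
    ∃ x : Fin m → E, (∀ i, 1 / 2 ≤ ‖x i‖) ∧
      ∀ a : Fin m → 𝕜, ‖∑ i, a i • x i‖ ^ 2 ≤ ∑ i, ‖a i‖ ^ 2 := by
  have hr : ((2 * m : ℕ) : Cardinal) ≤ Module.rank 𝕜 E := by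
    refine (Cardinal.natCast_le_aleph0).trans ?_
    by_contra h
    exact hE (Module.rank_lt_aleph0_iff.1 (not_le.1 h))
  obtain ⟨f, hf⟩ := exists_linearIndependent_of_le_rank hr
  set W := Submodule.span 𝕜 (Set.range f)
  have hW : Module.finrank 𝕜 W = 2 * m := by
    rw [finrank_span_eq_card hf]; simp
  have : FiniteDimensional 𝕜 W := FiniteDimensional.span_of_finite 𝕜 (Set.finite_range f)
  obtain ⟨x, h1, h2⟩ := dr_family (𝕜 := 𝕜) (W := W) m hW
  refine ⟨fun i => x i, h1, fun a => ?_⟩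
  have := h2 a
  have he : ∑ i, a i • (x i : E) = ((∑ i, a i • x i : W) : E) := by push_cast; rfl
  rw [he]
  exact this

lemma weak_two {𝕜 E ι : Type*} [RCLike 𝕜] [NormedAddCommGroup E] [NormedSpace 𝕜 E] [Fintype ι]
    (x : ι → E) (h : ∀ a : ι → 𝕜, ‖∑ i, a i • x i‖ ^ 2 ≤ ∑ i, ‖a i‖ ^ 2)
    (φ : E →L[𝕜] 𝕜) (hφ : ‖φ‖ ≤ 1) : ∑ i, ‖φ (x i)‖ ^ 2 ≤ 1 := by
  set S := ∑ i, ‖φ (x i)‖ ^ 2 with hS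
  have hS0 : 0 ≤ S := by positivity
  set v := ∑ i, (starRingEnd 𝕜 (φ (x i))) • x i with hv
  have h1 : ‖v‖ ^ 2 ≤ S := by
    have := h fun i => starRingEnd 𝕜 (φ (x i))
    simpa using this
  have h2 : φ v = (S : 𝕜) := by
    simp [hv, hS, RCLike.conj_mul]
  have h3 : S ≤ ‖v‖ := by
    have := φ.le_of_opNorm_le hφ v
    rw [h2, RCLike.norm_ofReal, abs_of_nonneg hS0] at this
    linarith
  nlinarith [norm_nonneg v]

lemma exists_signs {ι : Type*} [DecidableEq ι] (a : ι → ι → ℝ) (s : Finset ι) :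
    ∃ ε : ι → ℝ, (∀ i, |ε i| = 1) ∧
      ∑ i ∈ s, a i i ≤ ∑ i ∈ s, ∑ j ∈ s, ε i * ε j * a i j := by
  induction s using Finset.induction_on with
  | empty => exact ⟨fun _ => 1, by simp, by simp⟩
  | insert k s hk ih =>
    obtain ⟨ε, h1, h2⟩ := ih
    set r := ∑ j ∈ s, ε j * (a k j + a j k) with hr
    obtain ⟨σ, hσ, hσr⟩ : ∃ σ : ℝ, |σ| = 1 ∧ 0 ≤ σ * r := by
      rcases le_total 0 r with h | h
      · exact ⟨1, by simp, by simpa using h⟩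
      · exact ⟨-1, by simp, by linarith⟩
    refine ⟨Function.update ε k σ, fun i => ?_, ?_⟩
    · by_cases hi : i = k
      · subst hi; simpa using hσ
      · simpa [hi] using h1 i
    · have hne : ∀ i ∈ s, Function.update ε k σ i = ε i := fun i hi => by
        rw [Function.update_of_ne]; rintro rfl; exact hk hi
      have hσ2 : σ * σ = 1 := by rw [← abs_mul_abs_self, hσ]; norm_num
      rw [Finset.sum_insert hk, Finset.sum_insert hk, Finset.sum_insert hk]
      simp only [Function.update_self]
      have e1 : ∑ j ∈ s, σ * Function.update ε k σ j * a k j = σ * ∑ j ∈ s, ε j * a k j := by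
        rw [Finset.mul_sum]
        exact Finset.sum_congr rfl fun j hj => by rw [hne j hj]; ring
      have e2 : ∑ i ∈ s, ∑ j ∈ insert k s, Function.update ε k σ i * Function.update ε k σ j * a i j
          = σ * (∑ j ∈ s, ε j * a j k) + ∑ i ∈ s, ∑ j ∈ s, ε i * ε j * a i j := by
        rw [Finset.mul_sum, ← Finset.sum_add_distrib]
        refine Finset.sum_congr rfl fun i hi => ?_
        rw [Finset.sum_insert hk, hne i hi, Function.update_self]
        congr 1
        · ring
        · exact Finset.sum_congr rfl fun j hj => by rw [hne j hj]
      rw [e1, e2]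
      have e3 : σ * r = σ * ∑ j ∈ s, ε j * a k j + σ * (∑ j ∈ s, ε j * a j k) := by
        rw [hr, ← mul_add, ← Finset.sum_add_distrib]
        congr 1
        exact Finset.sum_congr rfl fun j hj => by ring
      rw [hσ2]
      linarith

lemma dual_infinite {𝕜 X : Type*} [RCLike 𝕜] [NormedAddCommGroup X] [NormedSpace 𝕜 X]
    (hX : ¬ FiniteDimensional 𝕜 X) : ¬ FiniteDimensional 𝕜 (X →L[𝕜] 𝕜) := by
  intro h
  apply hX
  have h2 : FiniteDimensional 𝕜 ((X →L[𝕜] 𝕜) →L[𝕜] 𝕜) := inferInstance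
  exact FiniteDimensional.of_injective
    (V₂ := (X →L[𝕜] 𝕜) →L[𝕜] 𝕜)
    ((NormedSpace.inclusionInDoubleDualLi (E := X) 𝕜).toLinearMap)
    (NormedSpace.inclusionInDoubleDualLi (E := X) 𝕜).injective

lemma core {𝕜 X : Type*} [RCLike 𝕜] [NormedAddCommGroup X] [NormedSpace 𝕜 X]
    (hX : ¬ FiniteDimensional 𝕜 X) (r m : ℕ) :
    ∃ (T : ContinuousMultilinearMap 𝕜 (fun _ : Fin (r + 1 + 1 + 1) => X) 𝕜)
      (x : Fin m → Fin (r + 1 + 1 + 1) → X) (lam : Fin m → 𝕜),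
      ‖T‖ ≤ √m ∧
      (∀ φ : Fin (r + 1 + 1 + 1) → {f : X →L[𝕜] 𝕜 // ‖f‖ ≤ 1},
        ‖∑ i, lam i • ∏ k, (φ k).1 (x i k)‖ ≤ 1) ∧
      (m : ℝ) / 16 ≤ ‖∑ i, lam i • T (x i)‖ := by
  obtain ⟨x, hx1, hx2⟩ := dvoretzky_rogers hX m
  obtain ⟨f, hf1, hf2⟩ := dvoretzky_rogers (dual_infinite hX) m
  choose g hg1 hg2 using fun i => exists_dual_vector'' 𝕜 (x i)
  have hw : ∀ i, ∃ w : X, ‖w‖ ≤ 1 ∧ ∃ c : ℝ, 1 / 4 ≤ c ∧ f i w = (c : 𝕜) := by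
    intro i
    obtain ⟨w, hw1, hw2⟩ := (f i).exists_lt_apply_of_lt_opNorm (r := 1 / 4)
      (by linarith [hf1 i])
    obtain ⟨c, hc, hcw⟩ := RCLike.exists_norm_eq_mul_self (f i w)
    refine ⟨c • w, by rw [norm_smul, hc]; linarith, ‖f i w‖, hw2.le, ?_⟩
    rw [map_smul, smul_eq_mul, hcw]
  choose w hw1 c hc hfw using hw
  have hnt : Nontrivial X := by
    by_contra h
    rw [not_nontrivial_iff_subsingleton] at h
    exact hX inferInstance
  obtain ⟨z, hz⟩ : ∃ z : X, ‖z‖ = 1 := by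
    obtain ⟨y, hy⟩ := exists_ne (0 : X)
    refine ⟨((‖y‖⁻¹ : ℝ) : 𝕜) • y, ?_⟩
    rw [norm_smul, RCLike.norm_ofReal, abs_of_nonneg (by positivity)]
    exact inv_mul_cancel₀ (norm_ne_zero_iff.2 hy)
  obtain ⟨h, hh1, hh2⟩ := exists_dual_vector'' 𝕜 z
  let G : Fin m → Fin (r + 1 + 1 + 1) → (X →L[𝕜] 𝕜) := fun i =>
    Fin.cons (α := fun _ => X →L[𝕜] 𝕜) (g i) (Fin.cons (α := fun _ => X →L[𝕜] 𝕜) (g i)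
      (Fin.cons (α := fun _ => X →L[𝕜] 𝕜) (f i) (fun _ => h)))
  let V : Fin m → Fin (r + 1 + 1 + 1) → X := fun j =>
    Fin.cons (α := fun _ => X) (x j) (Fin.cons (α := fun _ => X) (x j)
      (Fin.cons (α := fun _ => X) (w j) (fun _ => z)))
  have hG2 : ∀ i, (Fin.cons (α := fun _ => X →L[𝕜] 𝕜) (g i) (Fin.cons (α := fun _ => X →L[𝕜] 𝕜) (g i)
      (Fin.cons (α := fun _ => X →L[𝕜] 𝕜) (f i) (fun _ => h))) :
        Fin (r + 1 + 1 + 1) → (X →L[𝕜] 𝕜)) 2 = f i := fun _ => rfl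
  have hV2 : ∀ j, (Fin.cons (α := fun _ => X) (x j) (Fin.cons (α := fun _ => X) (x j)
      (Fin.cons (α := fun _ => X) (w j) (fun _ => z))) : Fin (r + 1 + 1 + 1) → X) 2 = w j :=
    fun _ => rfl
  obtain ⟨s, hs1, hs2⟩ := exists_signs (fun i j => RCLike.re (∏ k, G i k (V j k))) Finset.univ
  let T : ContinuousMultilinearMap 𝕜 (fun _ : Fin (r + 1 + 1 + 1) => X) 𝕜 :=
    ∑ i, (s i : 𝕜) • (ContinuousMultilinearMap.mkPiAlgebra 𝕜 (Fin (r + 1 + 1 + 1)) 𝕜).compContinuousLinearMap (G i)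
  have hT : ∀ v, T v = ∑ i, (s i : 𝕜) * ∏ k, G i k (v k) := by
    intro v
    simp [T]
  refine ⟨T, V, fun j => (s j : 𝕜), ?_, ?_, ?_⟩
  · refine ContinuousMultilinearMap.opNorm_le_bound (by positivity) fun v => ?_
    rw [hT]
    set M := ∏ k : Fin r, ‖v k.succ.succ.succ‖ with hM
    let b : Fin m → 𝕜 := fun i => (s i : 𝕜) * (g i (v 0) * g i (v 1) * ∏ k : Fin r, h (v k.succ.succ.succ))
    have e1 : ∑ i, (s i : 𝕜) * ∏ k, G i k (v k) = (∑ i, b i • f i) (v 2) := by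
      simp only [Fin.prod_univ_succ, G, b]
      simp [hG2]
      refine Finset.sum_congr rfl fun i _ => ?_
      ring
    have hb : ∀ i, ‖b i‖ ≤ ‖v 0‖ * ‖v 1‖ * M := by
      intro i
      simp only [b, norm_mul, RCLike.norm_ofReal, hs1, one_mul, norm_prod, hM]
      gcongr
      · simpa using (g i).le_of_opNorm_le (hg1 i) (v 0)
      · simpa using (g i).le_of_opNorm_le (hg1 i) (v 1)
      · simpa using h.le_of_opNorm_le hh1 _
    have e2 : ‖∑ i, b i • f i‖ ≤ √m * (‖v 0‖ * ‖v 1‖ * M) := by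
      have hM0 : 0 ≤ M := by positivity
      refine le_of_sq_le_sq ?_ (by positivity)
      refine (hf2 b).trans ?_
      rw [mul_pow, Real.sq_sqrt (by positivity)]
      calc ∑ i, ‖b i‖ ^ 2 ≤ ∑ i : Fin m, (‖v 0‖ * ‖v 1‖ * M) ^ 2 :=
            Finset.sum_le_sum fun i _ => by have := hb i; gcongr
        _ = _ := by simp
    rw [e1]
    refine ((∑ i, b i • f i).le_of_opNorm_le e2 (v 2)).trans (le_of_eq ?_)
    simp only [Fin.prod_univ_succ, hM]
    simp
    ring
  · intro φ
    have hφ0 := weak_two x hx2 (φ 0).1 (φ 0).2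
    have hφ1 := weak_two x hx2 (φ 1).1 (φ 1).2
    have hsm : ∀ (k) (y : X), ‖y‖ ≤ 1 → ‖(φ k).1 y‖ ≤ 1 := fun k y hy =>
      ((φ k).1.le_of_opNorm_le (φ k).2 y).trans (by linarith)
    calc ‖∑ i, (s i : 𝕜) • ∏ k, (φ k).1 (V i k)‖
        ≤ ∑ i, ‖(s i : 𝕜) • ∏ k, (φ k).1 (V i k)‖ := norm_sum_le _ _
      _ ≤ ∑ i, ((‖(φ 0).1 (x i)‖ ^ 2 + ‖(φ 1).1 (x i)‖ ^ 2) / 2) := by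
          refine Finset.sum_le_sum fun i _ => ?_
          rw [norm_smul, RCLike.norm_ofReal, hs1, one_mul, norm_prod, Fin.prod_univ_succ,
            Fin.prod_univ_succ]
          have hrest : ∏ k : Fin (r + 1), ‖(φ k.succ.succ).1 (V i k.succ.succ)‖ ≤ 1 := by
            refine Finset.prod_le_one (fun _ _ => norm_nonneg _) fun k _ => hsm _ _ ?_
            refine Fin.cases ?_ (fun k => ?_) k
            · simpa [V, hV2] using hw1 i
            · simp [V, hz]
          have hV0 : V i 0 = x i := rfl
          have hV1 : V i (Fin.succ 0) = x i := rfl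
          rw [hV0, hV1]
          have h1 : (Fin.succ 0 : Fin (r + 1 + 1 + 1)) = 1 := rfl
          rw [h1]
          have := mul_le_of_le_one_right (norm_nonneg ((φ 1).1 (x i))) hrest
          have := mul_le_mul_of_nonneg_left this (norm_nonneg ((φ 0).1 (x i)))
          nlinarith [sq_nonneg (‖(φ 0).1 (x i)‖ - ‖(φ 1).1 (x i)‖)]
      _ ≤ 1 := by
          rw [← Finset.sum_div, Finset.sum_add_distrib]
          linarith
  · have hdiag : ∀ i, 1 / 16 ≤ RCLike.re (∏ k, G i k (V i k)) := by
      intro i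
      have : ∏ k, G i k (V i k) = ((‖x i‖ * (‖x i‖ * c i) : ℝ) : 𝕜) := by
        simp only [Fin.prod_univ_succ, G, V]
        simp [hG2, hV2, hg2, hfw, hh2, hz]
      rw [this, RCLike.ofReal_re]
      have h1 := hx1 i
      have h2 := hc i
      nlinarith [mul_le_mul h1 h1 (by norm_num) (by positivity)]
    have hsum : (m : ℝ) / 16 ≤ ∑ i, RCLike.re (∏ k, G i k (V i k)) := by
      calc (m : ℝ) / 16 = ∑ i : Fin m, (1 / 16 : ℝ) := by simp; ring
        _ ≤ _ := Finset.sum_le_sum fun i _ => hdiag i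
    refine (hsum.trans hs2).trans (le_trans (le_of_eq ?_) (RCLike.re_le_norm _))
    simp only [hT, smul_eq_mul, Finset.mul_sum, map_sum]
    rw [Finset.sum_comm]
    refine Finset.sum_congr rfl fun i _ => Finset.sum_congr rfl fun j _ => ?_
    rw [← mul_assoc, ← RCLike.ofReal_mul, RCLike.re_ofReal_mul]
    ring

/-- for every `n ≥ 3`, every `p ≥ 1` and every infinite-dimensional Banach
space `X`, there is a continuous scalar-valued `n`-linear operator on `X` which is not
factorable `p`-dominated. -/
theorem exists_not_factorablePDominated
    {𝕜 : Type*} [RCLike 𝕜] (n : ℕ) (hn : 3 ≤ n) (p : ℝ) (hp : 1 ≤ p)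
    (X : Type*) [NormedAddCommGroup X] [NormedSpace 𝕜 X] [CompleteSpace X]
    (hX : ¬ FiniteDimensional 𝕜 X) :
    ∃ T : ContinuousMultilinearMap 𝕜 (fun _ : Fin n => X) 𝕜,
      ¬ FactorablePDominated 𝕜 p T := by
  obtain ⟨r, rfl⟩ : ∃ r, n = r + 1 + 1 + 1 := ⟨n - 3, by omega⟩
  by_contra hcon
  push Not at hcon
  let ι := {d : Σ m : ℕ, (Fin m → Fin (r + 1 + 1 + 1) → X) × (Fin m → 𝕜) //
    ∀ φ : Fin (r + 1 + 1 + 1) → {f : X →L[𝕜] 𝕜 // ‖f‖ ≤ 1},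
      ‖∑ i, d.2.2 i • ∏ k, (φ k).1 (d.2.1 i k)‖ ≤ 1}
  let L : ι → (ContinuousMultilinearMap 𝕜 (fun _ : Fin (r + 1 + 1 + 1) => X) 𝕜 →L[𝕜] 𝕜) := fun d =>
    ∑ i, d.1.2.2 i • ContinuousMultilinearMap.apply 𝕜 (fun _ : Fin (r + 1 + 1 + 1) => X) 𝕜 (d.1.2.1 i)
  have hL : ∀ d T, L d T = ∑ i, d.1.2.2 i • T (d.1.2.1 i) := by
    intro d T
    simp [L]
  have hp0 : p ≠ 0 := by linarith
  obtain ⟨C', hC'⟩ := banach_steinhaus (g := L) (by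
    intro T
    obtain ⟨C, hC0, hC⟩ := hcon T
    refine ⟨C, fun d => ?_⟩
    have h1 := hC 1 d.1.1 (fun _ => d.1.2.1) (fun _ => d.1.2.2)
    simp only [Finset.univ_unique, Finset.sum_const, Finset.card_singleton, one_smul] at h1
    rw [one_div, Real.rpow_rpow_inv (norm_nonneg _) hp0] at h1
    rw [hL]
    refine h1.trans (mul_le_of_le_one_right hC0 ?_)
    refine Real.iSup_le (fun φ => ?_) zero_le_one
    rw [Real.rpow_rpow_inv (norm_nonneg _) hp0]
    exact d.2 φ)
  obtain ⟨m, hm⟩ := exists_nat_gt ((16 * C') ^ 2)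
  obtain ⟨T, x, lam, h1, h2, h3⟩ := core hX r m
  have h4 := (L ⟨⟨m, x, lam⟩, h2⟩).le_of_opNorm_le (hC' _) T
  rw [hL] at h4
  have hC0 : 0 ≤ C' := (norm_nonneg _).trans (hC' ⟨⟨m, x, lam⟩, h2⟩)
  have h5 : (m : ℝ) / 16 ≤ C' * √m :=
    h3.trans (h4.trans (mul_le_mul_of_nonneg_left h1 hC0))
  have hsq : √(m : ℝ) * √m = m := Real.mul_self_sqrt (by positivity)
  have hlt : 16 * C' < √m := Real.lt_sqrt_of_sq_lt hm
  have hpos : 0 < √(m : ℝ) := lt_of_le_of_lt (by positivity) hlt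
  nlinarith
end

section
/- Let X be a Banach space, n a positive integer and 1 ≤ p < ∞. Every continuous n-linear operator T : X × ⋯ × X → X is strongly p-summing if and only if X is finite-dimensional. -/
open scoped BigOperators
open MeasureTheory

open scoped NNReal BoundedContinuousFunction in
lemma aux_pietsch {K ι : Type*} [Nonempty K] [TopologicalSpace K] (h : ι → K →ᵇ ℝ)
    (H : ∀ (s : Finset ι) (c : ι → ℝ≥0) (ε : ℝ), 0 < ε →
      ∃ k, ∑ i ∈ s, (c i : ℝ) * h i k < ε) :
    ∃ L : (K →ᵇ ℝ) →ₗ[ℝ] ℝ, L 1 = 1 ∧ (∀ f : K →ᵇ ℝ, (∀ k, 0 ≤ f k) → 0 ≤ L f) ∧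
      ∀ i, L (h i) ≤ 0 := by
  let U : Set (K →ᵇ ℝ) := {f | ∃ ε : ℝ, 0 < ε ∧ ∀ k, ε ≤ f k}
  let G : Submodule ℝ≥0 (K →ᵇ ℝ) := Submodule.span ℝ≥0 (Set.range h)
  have hUc : Convex ℝ U := by
    rintro f ⟨ε, hε, hf⟩ g ⟨δ, hδ, hg⟩ a b ha hb hab
    refine ⟨min ε δ, lt_min hε hδ, fun k => ?_⟩
    have h1 := (min_le_left ε δ).trans (hf k)
    have h2 := (min_le_right ε δ).trans (hg k)
    simp only [BoundedContinuousFunction.coe_add, BoundedContinuousFunction.coe_smul,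
      Pi.add_apply, smul_eq_mul]
    calc min ε δ = a * min ε δ + b * min ε δ := by rw [← add_mul, hab, one_mul]
      _ ≤ _ := by gcongr
  have hUo : IsOpen U := by
    rw [Metric.isOpen_iff]
    rintro f ⟨ε, hε, hf⟩
    refine ⟨ε / 2, by positivity, fun g hg => ⟨ε / 2, by positivity, fun k => ?_⟩⟩
    have h1 := (BoundedContinuousFunction.dist_coe_le_dist (f := g) (g := f) k).trans_lt hg
    rw [Real.dist_eq, abs_lt] at h1
    linarith [hf k]
  have hGc : Convex ℝ (G : Set (K →ᵇ ℝ)) := by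
    intro f hf g hg a b ha hb _
    have h1 := G.smul_mem (⟨a, ha⟩ : ℝ≥0) hf
    have h2 := G.smul_mem (⟨b, hb⟩ : ℝ≥0) hg
    exact G.add_mem h1 h2
  have hd : Disjoint U (G : Set (K →ᵇ ℝ)) := by
    rw [Set.disjoint_left]
    rintro f ⟨ε, hε, hf⟩ hG
    obtain ⟨c, rfl⟩ := Finsupp.mem_span_range_iff_exists_finsupp.1 hG
    obtain ⟨k, hk⟩ := H c.support c ε hε
    have := hf k
    rw [Finsupp.sum, BoundedContinuousFunction.sum_apply] at this
    exact absurd hk (not_lt.2 this)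
  obtain ⟨L, u, hL1, hL2⟩ := geometric_hahn_banach_open hUc hUo hGc hd
  have hu : u ≤ 0 := by simpa using hL2 0 G.zero_mem
  have h1U : (1 : K →ᵇ ℝ) ∈ U := ⟨1, one_pos, fun k => by simp⟩
  have hL1' : L 1 < 0 := (hL1 1 h1U).trans_le hu
  have hpos : ∀ f : K →ᵇ ℝ, (∀ k, 0 ≤ f k) → L f ≤ 0 := by
    intro f hf
    by_contra! hc
    have hmem : f + (L f / (- L 1)) • (1 : K →ᵇ ℝ) ∈ U := by
      refine ⟨L f / (- L 1), div_pos hc (by linarith), fun k => ?_⟩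
      simp [hf k]
    have := (hL1 _ hmem).trans_le hu
    rw [map_add, map_smul, smul_eq_mul] at this
    have h3 : L f / (- L 1) * L 1 = - L f := by
      have := hL1'.ne
      rw [div_neg, neg_mul, div_mul_cancel₀ _ this]
    linarith
  have hneg : ∀ i, 0 ≤ L (h i) := by
    intro i
    by_contra! hc
    have hm : h i ∈ G := Submodule.subset_span ⟨i, rfl⟩
    have h0 : (0 : ℝ) ≤ (u - 1) / L (h i) := by
      apply div_nonneg_of_nonpos <;> linarith
    have h1 := hL2 _ (G.smul_mem (⟨(u - 1) / L (h i), h0⟩ : ℝ≥0) hm)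
    have h2 : L ((⟨(u - 1) / L (h i), h0⟩ : ℝ≥0) • h i) = (u - 1) / L (h i) * L (h i) := by
      exact map_smul L ((u - 1) / L (h i)) (h i)
    have h3 := h1.trans_eq h2
    rw [div_mul_cancel₀ _ hc.ne] at h3
    linarith
  refine ⟨(L 1)⁻¹ • (L : (K →ᵇ ℝ) →ₗ[ℝ] ℝ), ?_, ?_, ?_⟩
  · simp [hL1'.ne]
  · intro f hf
    exact mul_nonneg_of_nonpos_of_nonpos (inv_nonpos.2 hL1'.le) (hpos f hf)
  · intro i
    exact mul_nonpos_of_nonpos_of_nonneg (inv_nonpos.2 hL1'.le) (hneg i)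

/-- Trace argument: a linear family of bounded functions whose `L²` norm dominates the
original norm lives in a finite-dimensional space. -/
lemma aux_trace {K X : Type*} [TopologicalSpace K]
    [NormedAddCommGroup X] [NormedSpace ℝ X]
    (R : X →ₗ[ℝ] (BoundedContinuousFunction K ℝ))
    (hR : ∀ x k, |R x k| ≤ ‖x‖)
    (L : (BoundedContinuousFunction K ℝ) →ₗ[ℝ] ℝ) (hL1 : L 1 = 1)
    (hLpos : ∀ f : BoundedContinuousFunction K ℝ, (∀ k, 0 ≤ f k) → 0 ≤ L f)
    (B : ℝ) (hB0 : 0 ≤ B) (hB : ∀ x, ‖x‖ ^ 2 ≤ B * L (R x * R x)) : Module.Finite ℝ X := by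
  obtain ⟨N, hN⟩ := exists_nat_ge B
  have key : Module.rank ℝ X ≤ (N : Cardinal) := by
    refine rank_le fun s hs => ?_
    let W := Submodule.span ℝ (s : Set X)
    have hfd : FiniteDimensional ℝ W := FiniteDimensional.span_finset ℝ s
    have hdim : Module.finrank ℝ W = s.card := finrank_span_finset_eq_card hs
    let b : LinearMap.BilinForm ℝ W := LinearMap.mk₂ ℝ (fun x y => L (R x * R y))
      (by intros; simp [add_mul])
      (by
        intro c x y
        have : R ((c • x : W) : X) * R y = c • (R x * R y) := by
          ext k; simp [mul_assoc]
        rw [this, map_smul])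
      (by intros; simp [mul_add])
      (by
        intro c x y
        have : R x * R ((c • y : W) : X) = c • (R x * R y) := by
          ext k; simp [mul_left_comm]
        rw [this, map_smul])
    have hsymm : LinearMap.IsSymm b := ⟨fun x y => by
      change L (R x * R y) = L (R y * R x)
      rw [mul_comm]⟩
    obtain ⟨v, hv⟩ := LinearMap.BilinForm.exists_orthogonal_basis hsymm
    have hq : ∀ i, 0 < b (v i) (v i) := by
      intro i
      have h1 : 0 ≤ b (v i) (v i) := hLpos _ fun k => by
        simpa using mul_self_nonneg _
      refine lt_of_le_of_ne h1 fun h0 => v.ne_zero i ?_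
      have h2 := hB (v i)
      change ‖((v i : W) : X)‖ ^ 2 ≤ B * b (v i) (v i) at h2
      rw [← h0, mul_zero] at h2
      have : ‖((v i : W) : X)‖ = 0 := by
        have := norm_nonneg ((v i : W) : X)
        nlinarith
      simpa using this
    set q := fun i => b (v i) (v i) with hqdef
    have hS : ∀ k, ∑ i, (R (v i) k) ^ 2 / q i ≤ B := by
      intro k
      set S := ∑ i, (R (v i) k) ^ 2 / q i with hSdef
      have hS0 : 0 ≤ S := Finset.sum_nonneg fun i _ => div_nonneg (sq_nonneg _) (hq i).le
      let y : W := ∑ i, (R (v i) k / q i) • v i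
      have hy1 : R y k = S := by
        simp only [y, Submodule.coe_sum, map_sum, BoundedContinuousFunction.sum_apply,
          Submodule.coe_smul, map_smul, BoundedContinuousFunction.coe_smul, smul_eq_mul, hSdef]
        exact Finset.sum_congr rfl fun i _ => by ring
      have hy2 : b y y = S := by
        simp only [y, map_sum, LinearMap.sum_apply, map_smul, LinearMap.smul_apply, smul_eq_mul,
          hSdef]
        refine Finset.sum_congr rfl fun i _ => ?_
        rw [Finset.sum_eq_single i]
        · have := (hq i).ne'
          change R (v i) k / q i * (R (v i) k / q i * q i) = _
          field_simp
        · intro j _ hj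
          have : b (v j) (v i) = 0 := hv hj
          simp [this]
        · simp
      have h3 : ‖(y : X)‖ ^ 2 ≤ B * S := by rw [← hy2]; exact hB y
      have h4 := hR y k
      rw [hy1, abs_of_nonneg hS0] at h4
      have h5 : S * S ≤ B * S := by nlinarith
      rcases hS0.eq_or_lt with h0 | h0
      · rw [← h0]
        exact hB0
      · exact le_of_mul_le_mul_right h5 h0
    have h7 : 0 ≤ L (B • 1 - ∑ i, (q i)⁻¹ • (R (v i) * R (v i))) := hLpos _ fun k => by
      have := hS k
      simp only [BoundedContinuousFunction.coe_sub, BoundedContinuousFunction.coe_smul,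
        Pi.sub_apply, BoundedContinuousFunction.sum_apply, BoundedContinuousFunction.coe_mul,
        Pi.mul_apply, smul_eq_mul, BoundedContinuousFunction.coe_one, Pi.one_apply, mul_one,
        sub_nonneg]
      refine le_trans (le_of_eq ?_) this
      exact Finset.sum_congr rfl fun i _ => by ring
    have h8 : ∀ i, (q i)⁻¹ * L (R (v i) * R (v i)) = 1 := fun i =>
      inv_mul_cancel₀ (hq i).ne'
    simp only [map_sub, map_smul, map_sum, hL1, smul_eq_mul, mul_one, h8, Finset.sum_const,
      Finset.card_univ, Fintype.card_fin, hdim, nsmul_eq_mul] at h7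
    exact_mod_cast (by linarith : (s.card : ℝ) ≤ N)
  exact Module.rank_lt_aleph0_iff.1 (key.trans_lt (Cardinal.natCast_lt_aleph0))

lemma aux_core {K X : Type*} [Nonempty K] [NormedAddCommGroup X] [NormedSpace ℝ X]
    (ev : K → X →ₗ[ℝ] ℝ) (hev : ∀ k x, |ev k x| ≤ ‖x‖) (p : ℝ) (hp : 1 ≤ p)
    (D : ℝ) (hD : 0 ≤ D)
    (H : ∀ (m : ℕ) (x : Fin m → X) (ε : ℝ), 0 < ε →
      ∃ k, ∑ j, ‖x j‖ ^ p < D * ∑ j, |ev k (x j)| ^ p + ε) : Module.Finite ℝ X := by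
  let _ : TopologicalSpace K := ⊥
  have : DiscreteTopology K := ⟨rfl⟩
  have hp0 : 0 < p := by linarith
  let R : X →ₗ[ℝ] (BoundedContinuousFunction K ℝ) :=
    { toFun := fun x => BoundedContinuousFunction.ofNormedAddCommGroupDiscrete
        (fun k => ev k x) ‖x‖ (fun k => hev k x)
      map_add' := fun x y => by ext k; simp
      map_smul' := fun c x => by ext k; simp }
  have hRk : ∀ x k, R x k = ev k x := fun x k => rfl
  let h : X → BoundedContinuousFunction K ℝ := fun x =>
    BoundedContinuousFunction.ofNormedAddCommGroupDiscrete
      (fun k => ‖x‖ ^ p - D * |ev k x| ^ p) (‖x‖ ^ p + D * ‖x‖ ^ p) (fun k => by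
        have h1 : |ev k x| ^ p ≤ ‖x‖ ^ p :=
          Real.rpow_le_rpow (abs_nonneg _) (hev k x) hp0.le
        have h2 : 0 ≤ |ev k x| ^ p := Real.rpow_nonneg (abs_nonneg _) _
        have h3 : 0 ≤ ‖x‖ ^ p := Real.rpow_nonneg (norm_nonneg _) _
        have h4 := mul_le_mul_of_nonneg_left h1 hD
        have h5 := mul_nonneg hD h2
        rw [Real.norm_eq_abs, abs_le]
        constructor <;> nlinarith)
  have hhk : ∀ x k, h x k = ‖x‖ ^ p - D * |ev k x| ^ p := fun x k => rfl
  obtain ⟨L, hL1, hLpos, hLh⟩ := aux_pietsch h (by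
    intro s c ε hε
    let y : Fin s.card → X := fun j =>
      ((c (s.equivFin.symm j) : ℝ) ^ (1 / p)) • (s.equivFin.symm j : X)
    obtain ⟨k, hk⟩ := H s.card y ε hε
    refine ⟨k, ?_⟩
    have hc : ∀ x, ((c x : ℝ) ^ (1 / p)) ^ p = c x := fun x => by
      rw [← Real.rpow_mul (NNReal.coe_nonneg (c x)), one_div_mul_cancel hp0.ne', Real.rpow_one]
    have hcn : ∀ x, 0 ≤ (c x : ℝ) ^ (1 / p) := fun x => Real.rpow_nonneg (c x).2 _
    have e1 : ∑ j, ‖y j‖ ^ p = ∑ x ∈ s, (c x : ℝ) * ‖x‖ ^ p := by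
      rw [← Finset.sum_coe_sort s, ← s.equivFin.symm.sum_comp]
      refine Finset.sum_congr rfl fun j _ => ?_
      simp only [y]
      rw [norm_smul, Real.norm_of_nonneg (hcn _), Real.mul_rpow (hcn _) (norm_nonneg _), hc]
    have e2 : ∑ j, |ev k (y j)| ^ p = ∑ x ∈ s, (c x : ℝ) * |ev k x| ^ p := by
      rw [← Finset.sum_coe_sort s, ← s.equivFin.symm.sum_comp]
      refine Finset.sum_congr rfl fun j _ => ?_
      simp only [y]
      rw [map_smul, smul_eq_mul, abs_mul, abs_of_nonneg (hcn _),
        Real.mul_rpow (hcn _) (abs_nonneg _), hc]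
    rw [e1, e2] at hk
    have e3 : ∑ x ∈ s, (c x : ℝ) * h x k =
        ∑ x ∈ s, (c x : ℝ) * ‖x‖ ^ p - D * ∑ x ∈ s, (c x : ℝ) * |ev k x| ^ p := by
      rw [Finset.mul_sum, ← Finset.sum_sub_distrib]
      exact Finset.sum_congr rfl fun x _ => by rw [hhk]; ring
    rw [e3]; linarith)
  set t₀ : ℝ := 1 / (2 * D + 2) with ht₀
  have ht₀pos : 0 < t₀ := by positivity
  have ht₀1 : t₀ ≤ 1 := by
    rw [ht₀, div_le_one (by positivity)]; linarith
  have hDt : D * t₀ ≤ 1 / 2 := by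
    rw [ht₀, mul_one_div, div_le_iff₀ (by positivity)]; linarith
  set A : ℝ := D / t₀ ^ 2 with hA
  have hA0 : 0 ≤ A := by positivity
  have hpt : ∀ t : ℝ, 0 ≤ t → t ≤ 1 → D * t ^ p ≤ 1 / 2 + A * t ^ 2 := by
    intro t h0 h1
    have hAt : 0 ≤ A * t ^ 2 := by positivity
    have htp : t ^ p ≤ t := by
      simpa using Real.rpow_le_rpow_of_exponent_ge' h0 h1 zero_le_one hp
    rcases le_total t t₀ with hle | hle
    · have := mul_le_mul_of_nonneg_left (htp.trans hle) hD
      linarith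
    · have h2 : D * t ^ p ≤ D := by
        have := mul_le_mul_of_nonneg_left (htp.trans h1) hD
        linarith
      have h3 : D ≤ A * t ^ 2 := by
        rw [hA, div_mul_eq_mul_div, le_div_iff₀ (by positivity)]
        have : t₀ ^ 2 ≤ t ^ 2 := by gcongr
        exact mul_le_mul_of_nonneg_left this hD
      linarith
  have hunit : ∀ x, ‖x‖ = 1 → 1 ≤ 2 * A * L (R x * R x) := by
    intro x hx
    have h1 : 0 ≤ L (h x + A • (R x * R x) - (1 / 2 : ℝ) • 1) := hLpos _ fun k => by
      have h2 := hpt _ (abs_nonneg (ev k x)) (hx ▸ hev k x)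
      simp only [BoundedContinuousFunction.coe_sub, BoundedContinuousFunction.coe_add,
        BoundedContinuousFunction.coe_smul, BoundedContinuousFunction.coe_mul, Pi.sub_apply,
        Pi.add_apply, Pi.mul_apply, hhk, hRk, hx, BoundedContinuousFunction.coe_one, Pi.one_apply,
        smul_eq_mul, Real.one_rpow]
      rw [sq_abs] at h2
      nlinarith
    rw [map_sub, map_add, map_smul, map_smul, hL1, smul_eq_mul, smul_eq_mul] at h1
    have := hLh x
    linarith
  refine aux_trace R (fun x k => hev k x) L hL1 hLpos (2 * A) (by positivity) fun x => ?_
  rcases eq_or_ne x 0 with rfl | hx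
  · simp
  have hn : ‖x‖ ≠ 0 := norm_ne_zero_iff.2 hx
  have h1 := hunit (‖x‖⁻¹ • x) (by rw [norm_smul, norm_inv, norm_norm, inv_mul_cancel₀ hn])
  have h2 : R (‖x‖⁻¹ • x) * R (‖x‖⁻¹ • x) = (‖x‖⁻¹ ^ 2) • (R x * R x) := by
    ext k; simp; ring
  rw [h2, map_smul, smul_eq_mul, inv_pow] at h1
  have hsq : 0 < ‖x‖ ^ 2 := by positivity
  calc ‖x‖ ^ 2 = ‖x‖ ^ 2 * 1 := (mul_one _).symm
    _ ≤ ‖x‖ ^ 2 * (2 * A * ((‖x‖ ^ 2)⁻¹ * L (R x * R x))) := by gcongr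
    _ = 2 * A * L (R x * R x) := by field_simp

lemma aux_core_rclike {𝕜 K X : Type*} [RCLike 𝕜] [Nonempty K] [NormedAddCommGroup X]
    [NormedSpace 𝕜 X] [NormedSpace ℝ X] [IsScalarTower ℝ 𝕜 X]
    (ev : K → X →ₗ[𝕜] 𝕜) (hev : ∀ k x, ‖ev k x‖ ≤ ‖x‖) (p : ℝ) (hp : 1 ≤ p)
    (C : ℝ) (hC : 0 ≤ C)
    (H : ∀ (m : ℕ) (x : Fin m → X),
      (∑ j, ‖x j‖ ^ p) ^ (1 / p) ≤ C * ⨆ k, (∑ j, ‖ev k (x j)‖ ^ p) ^ (1 / p)) :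
    Module.Finite 𝕜 X := by
  have hp0 : 0 < p := by linarith
  have hCp : 0 ≤ C ^ p := Real.rpow_nonneg hC _
  have H1 : ∀ (m : ℕ) (x : Fin m → X) (ε : ℝ), 0 < ε →
      ∃ k, ∑ j, ‖x j‖ ^ p < C ^ p * ∑ j, ‖ev k (x j)‖ ^ p + ε := by
    intro m x ε hε
    by_contra! hc
    have hnn : ∀ k, 0 ≤ ∑ j, ‖ev k (x j)‖ ^ p := fun k =>
      Finset.sum_nonneg fun j _ => Real.rpow_nonneg (norm_nonneg _) _
    set a := ∑ j, ‖x j‖ ^ p with ha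
    have haε : 0 ≤ a - ε := by
      obtain ⟨k⟩ := ‹Nonempty K›
      have := hc k
      have := mul_nonneg hCp (hnn k)
      linarith
    have h1 := H m x
    rw [Real.mul_iSup_of_nonneg hC] at h1
    have h2 : ⨆ k, C * (∑ j, ‖ev k (x j)‖ ^ p) ^ (1 / p) ≤ (a - ε) ^ (1 / p) := by
      refine ciSup_le fun k => ?_
      have h3 : C = (C ^ p) ^ (1 / p) := by
        rw [← Real.rpow_mul hC, mul_one_div_cancel hp0.ne', Real.rpow_one]
      rw [h3, ← Real.mul_rpow hCp (hnn k)]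
      refine Real.rpow_le_rpow (mul_nonneg hCp (hnn k)) ?_ (by positivity)
      linarith [hc k]
    have h4 : (a - ε) ^ (1 / p) < a ^ (1 / p) :=
      Real.rpow_lt_rpow haε (by linarith) (by positivity)
    linarith
  have hfin : Module.Finite ℝ X := by
    refine aux_core (K := K × Bool)
      (fun k => (if k.2 then RCLike.reLm else RCLike.imLm).comp ((ev k.1).restrictScalars ℝ))
      ?_ p hp (C ^ p * (2 ^ p * 2)) (by positivity) ?_
    · rintro ⟨k, b⟩ x
      refine le_trans ?_ (hev k x)
      cases b
      · simpa using RCLike.abs_im_le_norm (ev k x)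
      · simpa using RCLike.abs_re_le_norm (ev k x)
    · intro m x ε hε
      obtain ⟨k, hk⟩ := H1 m x ε hε
      set r := ∑ j, |RCLike.re (ev k (x j))| ^ p with hr
      set i := ∑ j, |RCLike.im (ev k (x j))| ^ p with hi
      have hle : ∑ j, ‖ev k (x j)‖ ^ p ≤ 2 ^ p * (r + i) := by
        rw [hr, hi, ← Finset.sum_add_distrib, Finset.mul_sum]
        refine Finset.sum_le_sum fun j _ => ?_
        have hn : ‖ev k (x j)‖ ≤ |RCLike.re (ev k (x j))| + |RCLike.im (ev k (x j))| := by
          refine abs_le_of_sq_le_sq' ?_ (by positivity) |>.2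
          rw [← RCLike.normSq_eq_def', RCLike.normSq_apply]
          nlinarith [abs_mul_abs_self (RCLike.re (ev k (x j))),
            abs_mul_abs_self (RCLike.im (ev k (x j))),
            mul_nonneg (abs_nonneg (RCLike.re (ev k (x j))))
              (abs_nonneg (RCLike.im (ev k (x j))))]
        set u := |RCLike.re (ev k (x j))|
        set w := |RCLike.im (ev k (x j))|
        have hu : 0 ≤ u := abs_nonneg _
        have hw : 0 ≤ w := abs_nonneg _
        have hup : 0 ≤ u ^ p := Real.rpow_nonneg hu _
        have hwp : 0 ≤ w ^ p := Real.rpow_nonneg hw _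
        have h2p : (0 : ℝ) ≤ 2 ^ p := by positivity
        rcases le_total u w with huw | huw
        · calc ‖ev k (x j)‖ ^ p ≤ (2 * w) ^ p :=
              Real.rpow_le_rpow (norm_nonneg _) (by linarith) hp0.le
            _ = 2 ^ p * w ^ p := Real.mul_rpow (by norm_num) hw
            _ ≤ _ := mul_le_mul_of_nonneg_left (by linarith) h2p
        · calc ‖ev k (x j)‖ ^ p ≤ (2 * u) ^ p :=
              Real.rpow_le_rpow (norm_nonneg _) (by linarith) hp0.le
            _ = 2 ^ p * u ^ p := Real.mul_rpow (by norm_num) hu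
            _ ≤ _ := mul_le_mul_of_nonneg_left (by linarith) h2p
      have h2p : (0 : ℝ) ≤ 2 ^ p := by positivity
      have hle' := mul_le_mul_of_nonneg_left hle hCp
      have hCC := mul_nonneg hCp h2p
      rcases le_total r i with h | h
      · refine ⟨(k, false), ?_⟩
        have e : C ^ p * (2 ^ p * 2) * i + ε = C ^ p * 2 ^ p * (2 * i) + ε := by ring
        have : C ^ p * 2 ^ p * (r + i) ≤ C ^ p * 2 ^ p * (2 * i) :=
          mul_le_mul_of_nonneg_left (by linarith) hCC
        have g : ∑ j, ‖x j‖ ^ p < C ^ p * (2 ^ p * 2) * i + ε := by rw [e]; linarith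
        simpa [hi] using g
      · refine ⟨(k, true), ?_⟩
        have e : C ^ p * (2 ^ p * 2) * r + ε = C ^ p * 2 ^ p * (2 * r) + ε := by ring
        have : C ^ p * 2 ^ p * (r + i) ≤ C ^ p * 2 ^ p * (2 * r) :=
          mul_le_mul_of_nonneg_left (by linarith) hCC
        have g : ∑ j, ‖x j‖ ^ p < C ^ p * (2 ^ p * 2) * r + ε := by rw [e]; linarith
        simpa [hr] using g
  exact Module.Finite.of_restrictScalars_finite ℝ 𝕜 X

lemma aux_forward {𝕜 : Type*} [RCLike 𝕜] (n : ℕ) (hn : 0 < n) (p : ℝ) (hp : 1 ≤ p)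
    (X : Type*) [NormedAddCommGroup X] [NormedSpace 𝕜 X]
    (H : ∀ T : ContinuousMultilinearMap 𝕜 (fun _ : Fin n => X) X, StronglySumming 𝕜 p T) :
    FiniteDimensional 𝕜 X := by
  rcases subsingleton_or_nontrivial X with hX | hX
  · infer_instance
  obtain ⟨n, rfl⟩ := Nat.exists_eq_succ_of_ne_zero hn.ne'
  obtain ⟨e₀, he₀⟩ := exists_ne (0 : X)
  have hn₀ : ‖e₀‖ ≠ 0 := norm_ne_zero_iff.2 he₀
  obtain ⟨e, he⟩ : ∃ e : X, ‖e‖ = 1 := ⟨((‖e₀‖⁻¹ : ℝ) : 𝕜) • e₀, by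
    rw [norm_smul, RCLike.norm_ofReal, abs_inv, abs_norm, inv_mul_cancel₀ hn₀]⟩
  obtain ⟨f, -, hf⟩ := exists_dual_vector 𝕜 e (by rw [he]; exact one_ne_zero)
  have hfe : f e = 1 := by rw [hf, he]; simp
  let A : ContinuousMultilinearMap 𝕜 (fun _ : Fin n => X) 𝕜 :=
    (ContinuousMultilinearMap.mkPiAlgebra 𝕜 (Fin n) 𝕜).compContinuousLinearMap (fun _ => f)
  let T : ContinuousMultilinearMap 𝕜 (fun _ : Fin (n + 1) => X) X :=
    ContinuousLinearMap.uncurryLeft (Ei := fun _ : Fin (n + 1) => X)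
      (ContinuousMultilinearMap.smulRightL 𝕜 (fun _ : Fin n => X) X A)
  have hT : ∀ x : X, T (Fin.cons x fun _ => e) = x := by
    intro x
    simp [T, A, hfe]
  obtain ⟨C, hC, hb⟩ := H T
  let _ : NormedSpace ℝ X := NormedSpace.restrictScalars ℝ 𝕜 X
  have : IsScalarTower ℝ 𝕜 X := RestrictScalars.isScalarTower ℝ 𝕜 X
  let ev : {φ : ContinuousMultilinearMap 𝕜 (fun _ : Fin (n + 1) => X) 𝕜 // ‖φ‖ ≤ 1} →
      X →ₗ[𝕜] 𝕜 := fun φ =>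
    { toFun := fun x => φ.1 (Fin.cons x fun _ => e)
      map_add' := fun x y => φ.1.toMultilinearMap.cons_add (fun _ => e) x y
      map_smul' := fun c x => φ.1.toMultilinearMap.cons_smul (fun _ => e) c x }
  have : Nonempty {φ : ContinuousMultilinearMap 𝕜 (fun _ : Fin (n + 1) => X) 𝕜 // ‖φ‖ ≤ 1} :=
    ⟨⟨0, by simp⟩⟩
  refine aux_core_rclike ev ?_ p hp C hC ?_
  · intro φ x
    have h1 := φ.1.le_of_opNorm_le φ.2 (Fin.cons x fun _ => e)
    change ‖φ.1 (Fin.cons x fun _ => e)‖ ≤ ‖x‖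
    simpa [Fin.prod_univ_succ, he] using h1
  · intro m x
    have := hb m (fun j => Fin.cons (x j) fun _ => e)
    simp only [hT] at this
    exact this

lemma aux_backward {𝕜 : Type*} [RCLike 𝕜] (n : ℕ) (p : ℝ) (hp : 1 ≤ p)
    (X : Type*) [NormedAddCommGroup X] [NormedSpace 𝕜 X] [FiniteDimensional 𝕜 X]
    (T : ContinuousMultilinearMap 𝕜 (fun _ : Fin n => X) X) : StronglySumming 𝕜 p T := by
  have hp0 : 0 < p := by linarith
  let b := Module.finBasis 𝕜 X
  set d := Module.finrank 𝕜 X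
  let φ : Fin d → ContinuousMultilinearMap 𝕜 (fun _ : Fin n => X) 𝕜 := fun i =>
    (LinearMap.toContinuousLinearMap (b.coord i)).compContinuousMultilinearMap T
  set M : ℝ := (d : ℝ) ^ (p - 1) * ∑ i, (‖b i‖ * (‖φ i‖ + 1)) ^ p with hM
  have hM0 : 0 ≤ M := by positivity
  refine ⟨M ^ (1 / p), by positivity, fun m x => ?_⟩
  set S := ⨆ φ : {φ : ContinuousMultilinearMap 𝕜 (fun _ : Fin n => X) 𝕜 // ‖φ‖ ≤ 1},
        (∑ j, ‖φ.1 (x j)‖ ^ p) ^ (1 / p) with hS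
  have hbdd : BddAbove (Set.range fun φ : {φ : ContinuousMultilinearMap 𝕜
      (fun _ : Fin n => X) 𝕜 // ‖φ‖ ≤ 1} => (∑ j, ‖φ.1 (x j)‖ ^ p) ^ (1 / p)) := by
    refine ⟨(∑ j, (1 * ∏ k, ‖x j k‖) ^ p) ^ (1 / p), ?_⟩
    rintro _ ⟨ψ, rfl⟩
    refine Real.rpow_le_rpow (by positivity) (Finset.sum_le_sum fun j _ => ?_) (by positivity)
    exact Real.rpow_le_rpow (norm_nonneg _) (ψ.1.le_of_opNorm_le ψ.2 _) hp0.le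
  have hS0 : 0 ≤ S := Real.iSup_nonneg fun ψ => by positivity
  have hφ : ∀ i, ∑ j, ‖φ i (x j)‖ ^ p ≤ (‖φ i‖ + 1) ^ p * S ^ p := by
    intro i
    have hc : 0 < ‖φ i‖ + 1 := by positivity
    let ψ : ContinuousMultilinearMap 𝕜 (fun _ : Fin n => X) 𝕜 :=
      (((‖φ i‖ + 1)⁻¹ : ℝ) : 𝕜) • φ i
    have hcn : ‖(((‖φ i‖ + 1)⁻¹ : ℝ) : 𝕜)‖ = (‖φ i‖ + 1)⁻¹ := by
      rw [RCLike.norm_ofReal, abs_of_pos (by positivity)]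
    have hψ : ‖ψ‖ ≤ 1 := by
      simp only [ψ]
      rw [norm_smul, hcn, inv_mul_le_iff₀ hc]; linarith
    have h1 : (∑ j, ‖ψ (x j)‖ ^ p) ^ (1 / p) ≤ S := le_ciSup hbdd ⟨ψ, hψ⟩
    have h2 : ∑ j, ‖ψ (x j)‖ ^ p ≤ S ^ p := by
      have h3 := Real.rpow_le_rpow (by positivity) h1 hp0.le
      rwa [← Real.rpow_mul (by positivity), one_div_mul_cancel hp0.ne', Real.rpow_one] at h3
    calc ∑ j, ‖φ i (x j)‖ ^ p = (‖φ i‖ + 1) ^ p * ∑ j, ‖ψ (x j)‖ ^ p := by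
          rw [Finset.mul_sum]
          refine Finset.sum_congr rfl fun j _ => ?_
          rw [← Real.mul_rpow hc.le (norm_nonneg _)]
          congr 1
          change _ = (‖φ i‖ + 1) * ‖(((‖φ i‖ + 1)⁻¹ : ℝ) : 𝕜) • φ i (x j)‖
          rw [norm_smul, hcn, mul_inv_cancel_left₀ hc.ne']
      _ ≤ _ := by gcongr
  have hpt : ∀ j, ‖T (x j)‖ ^ p ≤ (d : ℝ) ^ (p - 1) * ∑ i, ‖b i‖ ^ p * ‖φ i (x j)‖ ^ p := by
    intro j
    have h1 : ‖T (x j)‖ ≤ ∑ i, |‖b i‖ * ‖φ i (x j)‖| := by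
      conv_lhs => rw [← b.sum_repr (T (x j))]
      refine (norm_sum_le _ _).trans (Finset.sum_le_sum fun i _ => ?_)
      rw [norm_smul, mul_comm]
      exact le_abs_self _
    have h2 := Real.rpow_sum_le_const_mul_sum_rpow Finset.univ
      (fun i => ‖b i‖ * ‖φ i (x j)‖) hp
    refine (Real.rpow_le_rpow (norm_nonneg _) h1 hp0.le).trans (h2.trans (le_of_eq ?_))
    rw [Finset.card_univ, Fintype.card_fin]
    congr 1
    refine Finset.sum_congr rfl fun i _ => ?_
    rw [abs_of_nonneg (by positivity), Real.mul_rpow (norm_nonneg _) (norm_nonneg _)]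
  have htot : ∑ j, ‖T (x j)‖ ^ p ≤ M * S ^ p := by
    calc ∑ j, ‖T (x j)‖ ^ p
        ≤ ∑ j, (d : ℝ) ^ (p - 1) * ∑ i, ‖b i‖ ^ p * ‖φ i (x j)‖ ^ p :=
          Finset.sum_le_sum fun j _ => hpt j
      _ = (d : ℝ) ^ (p - 1) * ∑ i, ‖b i‖ ^ p * ∑ j, ‖φ i (x j)‖ ^ p := by
          rw [← Finset.mul_sum, Finset.sum_comm]
          simp only [Finset.mul_sum]
      _ ≤ (d : ℝ) ^ (p - 1) * ∑ i, ‖b i‖ ^ p * ((‖φ i‖ + 1) ^ p * S ^ p) := by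
          gcongr with i
          exact hφ i
      _ = M * S ^ p := by
          rw [hM, mul_assoc, Finset.sum_mul]
          congr 1
          refine Finset.sum_congr rfl fun i _ => ?_
          rw [Real.mul_rpow (norm_nonneg _) (by positivity)]; ring
  calc (∑ j, ‖T (x j)‖ ^ p) ^ (1 / p) ≤ (M * S ^ p) ^ (1 / p) :=
        Real.rpow_le_rpow (by positivity) htot (by positivity)
    _ = M ^ (1 / p) * S := by
        rw [Real.mul_rpow hM0 (by positivity), ← Real.rpow_mul hS0,
          mul_one_div_cancel hp0.ne', Real.rpow_one]

/-- every continuous `n`-linear operator `T : X × ⋯ × X → X` is strongly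
`p`-summing if and only if `X` is finite-dimensional. -/
theorem stronglySumming_coincidence_iff_finiteDimensional
    {𝕜 : Type*} [RCLike 𝕜] (n : ℕ) (hn : 0 < n) (p : ℝ) (hp : 1 ≤ p)
    (X : Type*) [NormedAddCommGroup X] [NormedSpace 𝕜 X] [CompleteSpace X] :
    (∀ T : ContinuousMultilinearMap 𝕜 (fun _ : Fin n => X) X, StronglySumming 𝕜 p T) ↔
      FiniteDimensional 𝕜 X := by
  exact ⟨aux_forward n hn p hp X, fun _ T => aux_backward n p hp X T⟩
end

section
/- (Composition Theorem) Let 1 ≤ p, q < ∞ and let r be defined by 1/r = min{1, 1/p + 1/q}. If u : X → Y is an absolutely p-summing linear operator and P : G → X is a factorable strongly q-summing m-homogeneous polynomial between Banach spaces, then u ∘ P : G → Y is a factorable strongly r-summing m-homogeneous polynomial. -/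
open scoped BigOperators
open MeasureTheory

theorem aux_holder3 {ι : Type*} [Fintype ι] (a b c : ι → ℝ) (ha : ∀ i, 0 ≤ a i) (hb : ∀ i, 0 ≤ b i)
    (hc : ∀ i, 0 ≤ c i) {A B C w₁ w₂ w₃ : ℝ} (hA : 0 < A) (hB : 0 < B) (hC : 0 < C)
    (h₁ : 0 ≤ w₁) (h₂ : 0 ≤ w₂) (h₃ : 0 ≤ w₃) (hw : w₁ + w₂ + w₃ = 1)
    (hAs : ∑ i, a i ≤ A) (hBs : ∑ i, b i ≤ B) (hCs : ∑ i, c i ≤ C) :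
    ∑ i, a i ^ w₁ * b i ^ w₂ * c i ^ w₃ ≤ A ^ w₁ * B ^ w₂ * C ^ w₃ := by
  have key : ∀ i, a i ^ w₁ * b i ^ w₂ * c i ^ w₃ ≤
      (A ^ w₁ * B ^ w₂ * C ^ w₃) * (w₁ * (a i / A) + w₂ * (b i / B) + w₃ * (c i / C)) := by
    intro i
    have h := Real.geom_mean_le_arith_mean3_weighted h₁ h₂ h₃ (div_nonneg (ha i) hA.le)
      (div_nonneg (hb i) hB.le) (div_nonneg (hc i) hC.le) hw
    rw [Real.div_rpow (ha i) hA.le, Real.div_rpow (hb i) hB.le, Real.div_rpow (hc i) hC.le] at h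
    have hA' := Real.rpow_pos_of_pos hA w₁
    have hB' := Real.rpow_pos_of_pos hB w₂
    have hC' := Real.rpow_pos_of_pos hC w₃
    refine le_trans (le_of_eq ?_) (mul_le_mul_of_nonneg_left h (by positivity))
    field_simp
  refine (Finset.sum_le_sum fun i _ => key i).trans ?_
  rw [← Finset.mul_sum]
  have hK : 0 ≤ A ^ w₁ * B ^ w₂ * C ^ w₃ := by positivity
  refine mul_le_of_le_one_right hK ?_
  rw [Finset.sum_add_distrib, Finset.sum_add_distrib, ← Finset.mul_sum, ← Finset.mul_sum,
    ← Finset.mul_sum, ← Finset.sum_div, ← Finset.sum_div, ← Finset.sum_div]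
  have e1 : (∑ i, a i) / A ≤ 1 := (div_le_one hA).2 hAs
  have e2 : (∑ i, b i) / B ≤ 1 := (div_le_one hB).2 hBs
  have e3 : (∑ i, c i) / C ≤ 1 := (div_le_one hC).2 hCs
  nlinarith

theorem aux_holder2 {ι : Type*} [Fintype ι] (a b : ι → ℝ) (ha : ∀ i, 0 ≤ a i) (hb : ∀ i, 0 ≤ b i)
    {A B w₁ w₂ : ℝ} (hA : 0 < A) (hB : 0 < B)
    (h₁ : 0 ≤ w₁) (h₂ : 0 ≤ w₂) (hw : w₁ + w₂ = 1)
    (hAs : ∑ i, a i ≤ A) (hBs : ∑ i, b i ≤ B) :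
    ∑ i, a i ^ w₁ * b i ^ w₂ ≤ A ^ w₁ * B ^ w₂ := by
  have := aux_holder3 a b b ha hb hb hA hB hB h₁ h₂ le_rfl (by linarith) hAs hBs hBs
  simpa using this

theorem aux_add_rpow {a b q : ℝ} (ha : 0 ≤ a) (hb : 0 ≤ b) (hq : 1 ≤ q) :
    (a + b) ^ q ≤ 2 ^ q * (a ^ q + b ^ q) := by
  have h2 : (0:ℝ) ≤ 2 ^ q := by positivity
  have hap : 0 ≤ a ^ q := by positivity
  have hbp : 0 ≤ b ^ q := by positivity
  rcases le_total a b with h | h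
  · calc (a + b) ^ q ≤ (2 * b) ^ q := Real.rpow_le_rpow (by positivity) (by linarith) (by linarith)
      _ = 2 ^ q * b ^ q := Real.mul_rpow (by norm_num) hb
      _ ≤ _ := by gcongr; linarith
  · calc (a + b) ^ q ≤ (2 * a) ^ q := Real.rpow_le_rpow (by positivity) (by linarith) (by linarith)
      _ = 2 ^ q * a ^ q := Real.mul_rpow (by norm_num) ha
      _ ≤ _ := by gcongr; linarith

/-- Finite domination. -/
theorem aux_domination {K S : Type*} [Nonempty K] [Fintype S] (f : S → ℝ) (g : S → K → ℝ)
    (hg : ∀ s k, 0 ≤ g s k) {D : ℝ} (hD : 0 < D)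
    (H : ∀ (c : S → ℝ) (B : ℝ), (∀ s, 0 ≤ c s) → 0 ≤ B → (∀ k, ∑ s, c s * g s k ≤ B) →
      ∑ s, c s * f s ≤ D * B) :
    ∃ (ι : Type) (_ : Fintype ι) (μ : ι → ℝ) (κ : ι → K), (∀ i, 0 ≤ μ i) ∧ ∑ i, μ i = 1 ∧
      ∀ s, f s ≤ D * (∑ i, μ i * g s (κ i)) + 1 := by
  classical
  let U : Set (S → ℝ) := {a | ∀ s, f s < D * a s + 1}
  let V : Set (S → ℝ) := convexHull ℝ (Set.range fun k : K => fun s => g s k)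
  by_cases hdis : Disjoint U V
  · exfalso
    have hUc : Convex ℝ U := by
      intro a ha b hb x y hx hy hxy s
      have h1 := ha s
      have h2 := hb s
      simp only [Pi.add_apply, Pi.smul_apply, smul_eq_mul]
      have : f s = x * f s + y * f s := by rw [← add_mul, hxy, one_mul]
      have e : D * (x * a s + y * b s) + 1 = x * (D * a s + 1) + y * (D * b s + 1) := by
        linear_combination (-1) * hxy
      rw [this, e]
      rcases hx.eq_or_lt with h | h
      · have : y = 1 := by linarith
        subst this; rw [← h]; linarith
      · have := mul_lt_mul_of_pos_left h1 h
        have := mul_le_mul_of_nonneg_left h2.le hy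
        linarith
    have hUo : IsOpen U := by
      have : U = ⋂ s, {a : S → ℝ | f s < D * a s + 1} := by ext; simp [U]
      rw [this]
      exact isOpen_iInter_of_finite fun s => isOpen_lt continuous_const (by fun_prop)
    obtain ⟨F, γ, hF1, hF2⟩ := geometric_hahn_banach_open hUc hUo (convex_convexHull ℝ _) hdis
    have hrep : ∀ a : S → ℝ, F a = ∑ s, a s * F (Pi.single s 1) := by
      intro a
      conv_lhs => rw [pi_eq_sum_univ' a]
      simp [map_sum]
    let d : S → ℝ := fun s => f s / D
    have hd : d ∈ U := by
      intro s
      simp only [d]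
      rw [mul_div_cancel₀ _ hD.ne']; linarith
    have hneg : ∀ s, F (Pi.single s 1) ≤ 0 := by
      intro s
      by_contra hpos
      push Not at hpos
      set e := F (Pi.single s 1) with he
      have hT : 0 ≤ |γ - F d| / e := by positivity
      have hmem : d + (|γ - F d| / e) • (Pi.single s 1 : S → ℝ) ∈ U := by
        intro s'
        have h1 := hd s'
        have h2 : 0 ≤ (Pi.single s 1 : S → ℝ) s' := by
          by_cases h : s' = s
          · subst h; simp
          · simp [h]
        simp only [Pi.add_apply, Pi.smul_apply, smul_eq_mul]
        have : 0 ≤ D * (|γ - F d| / e * (Pi.single s 1 : S → ℝ) s') := by positivity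
        linarith
      have := hF1 _ hmem
      rw [map_add, map_smul, ← he, smul_eq_mul, div_mul_cancel₀ _ hpos.ne'] at this
      have := le_abs_self (γ - F d)
      linarith
    have hk : ∀ k, ∑ s, (-F (Pi.single s 1)) * g s k ≤ -γ := by
      intro k
      have := hF2 _ (subset_convexHull ℝ _ ⟨k, rfl⟩)
      rw [hrep] at this
      have e : ∑ s, (-F (Pi.single s 1)) * g s k = - ∑ s, g s k * F (Pi.single s 1) := by
        rw [← Finset.sum_neg_distrib]; exact Finset.sum_congr rfl fun s _ => by ring
      rw [e]; linarith
    have hγ : 0 ≤ -γ := by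
      obtain ⟨k⟩ := ‹Nonempty K›
      refine le_trans (Finset.sum_nonneg fun s _ => ?_) (hk k)
      exact mul_nonneg (by linarith [hneg s]) (hg s k)
    have h1 := H _ (-γ) (fun s => by linarith [hneg s]) hγ hk
    have h2 := hF1 d hd
    rw [hrep] at h2
    have e : ∑ s, (-F (Pi.single s 1)) * f s = - (D * ∑ s, d s * F (Pi.single s 1)) := by
      rw [Finset.mul_sum, ← Finset.sum_neg_distrib]
      refine Finset.sum_congr rfl fun s _ => ?_
      simp only [d]; field_simp
    rw [e] at h1
    nlinarith
  · rw [Set.not_disjoint_iff] at hdis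
    obtain ⟨a, haU, haV⟩ := hdis
    simp only [V] at haV
    rw [convexHull_eq] at haV
    obtain ⟨ι, t, w, z, hw0, hw1, hz, hc⟩ := haV
    choose! κ hκ using hz
    refine ⟨t, inferInstance, fun i => w i, fun i => κ i, fun i => hw0 i i.2, ?_, ?_⟩
    · rw [← hw1]; exact Finset.sum_coe_sort t w
    · intro s
      have h := haU s
      rw [← hc, Finset.centerMass_eq_of_sum_1 _ _ hw1] at h
      have e : (∑ i ∈ t, w i • z i) s = ∑ i : t, w i * g s (κ i) := by
        rw [Finset.sum_apply, ← Finset.sum_coe_sort t]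
        refine Finset.sum_congr rfl fun i _ => ?_
        rw [← hκ i i.2]; simp
      rw [e] at h
      exact h.le

/-- Domination on a ball. -/
theorem aux_dom_ball {𝕜 : Type*} [RCLike 𝕜] {X : Type*} [NormedAddCommGroup X] [NormedSpace 𝕜 X]
    {K : Type*} [Nonempty K] {n : ℕ} (v : Fin n → X) (z : Fin n → K → 𝕜)
    (hz : ∀ j k, ‖z j k‖ ≤ 1) {q D R : ℝ} (hq : 1 ≤ q) (hD : 0 < D)
    (H : ∀ (S : Type) [Fintype S] (β : S → Fin n → 𝕜) (B : ℝ), 0 ≤ B →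
      (∀ k, ∑ s, ‖∑ j, β s j * z j k‖ ^ q ≤ B) → ∑ s, ‖∑ j, β s j • v j‖ ^ q ≤ D * B) :
    ∃ (ι : Type) (_ : Fintype ι) (μ : ι → ℝ) (κ : ι → K), (∀ i, 0 ≤ μ i) ∧ ∑ i, μ i = 1 ∧
      ∀ β : Fin n → 𝕜, (∀ j, ‖β j‖ ≤ R) → ‖∑ j, β j • v j‖ ^ q ≤
        (2 ^ q * (D * 2 ^ q + 2)) * (∑ i, μ i * ‖∑ j, β j * z j (κ i)‖ ^ q + 1) := by
  have hq0 : 0 < q := by linarith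
  set N : ℝ := ∑ j, ‖v j‖ + n + 1 with hN
  have hNv : 0 ≤ ∑ j, ‖v j‖ := Finset.sum_nonneg fun _ _ => norm_nonneg _
  have hN0 : 0 < N := by positivity
  have hcpt : IsCompact (Metric.closedBall (0 : Fin n → 𝕜) (max R 0)) := isCompact_closedBall _ _
  obtain ⟨t, -, htf, hcov⟩ := hcpt.finite_cover_balls (e := 1 / N) (by positivity)
  obtain ⟨M, ⟨eq⟩⟩ : ∃ M : ℕ, Nonempty (Fin M ≃ t) := by
    have := htf.fintype
    exact ⟨Fintype.card t, ⟨(Fintype.equivFin t).symm⟩⟩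
  let b : Fin M → Fin n → 𝕜 := fun s => (eq s).1
  obtain ⟨ι, hι, μ, κ, hμ0, hμ1, hdom⟩ := aux_domination (K := K)
    (fun s => ‖∑ j, b s j • v j‖ ^ q) (fun s k => ‖∑ j, b s j * z j k‖ ^ q)
    (fun s k => by positivity) hD (by
      intro c B hc hB hk
      have hcq : ∀ s, ‖((c s ^ (1 / q) : ℝ) : 𝕜)‖ ^ q = c s := by
        intro s
        rw [RCLike.norm_ofReal, abs_of_nonneg (Real.rpow_nonneg (hc s) _), ← Real.rpow_mul (hc s),
          one_div_mul_cancel hq0.ne', Real.rpow_one]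
      have := H (Fin M) (fun s j => ((c s ^ (1 / q) : ℝ) : 𝕜) * b s j) B hB (by
        intro k
        refine le_trans (le_of_eq ?_) (hk k)
        refine Finset.sum_congr rfl fun s _ => ?_
        simp_rw [mul_assoc]
        rw [← Finset.mul_sum, norm_mul, Real.mul_rpow (norm_nonneg _) (norm_nonneg _), hcq])
      refine le_trans (le_of_eq ?_) this
      refine Finset.sum_congr rfl fun s _ => ?_
      simp_rw [mul_smul]
      rw [← Finset.smul_sum, norm_smul, Real.mul_rpow (norm_nonneg _) (norm_nonneg _), hcq])
  refine ⟨ι, hι, μ, κ, hμ0, hμ1, ?_⟩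
  intro β hβ
  have hβm : β ∈ Metric.closedBall (0 : Fin n → 𝕜) (max R 0) := by
    rw [mem_closedBall_zero_iff, pi_norm_le_iff_of_nonneg (le_max_right _ _)]
    exact fun j => (hβ j).trans (le_max_left _ _)
  have := hcov hβm
  simp only [Set.mem_iUnion] at this
  obtain ⟨y, hy, hyd⟩ := this
  obtain ⟨s, hs⟩ := eq.surjective ⟨y, hy⟩
  have hbs : b s = y := by simp [b, hs]
  have hdj : ∀ j, ‖β j - b s j‖ ≤ 1 / N := by
    intro j
    rw [hbs]
    rw [Metric.mem_ball, dist_eq_norm] at hyd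
    exact (norm_le_pi_norm (β - y) j).trans hyd.le
  have hQ : (1:ℝ) ≤ 2 ^ q := Real.one_le_rpow (by norm_num) hq0.le
  have h1 : ‖∑ j, β j • v j‖ ≤ ‖∑ j, b s j • v j‖ + 1 := by
    have e : ∑ j, β j • v j = ∑ j, b s j • v j + ∑ j, (β j - b s j) • v j := by
      rw [← Finset.sum_add_distrib]
      exact Finset.sum_congr rfl fun j _ => by rw [← add_smul]; congr 1; ring
    rw [e]
    refine (norm_add_le _ _).trans (add_le_add le_rfl ?_)
    calc ‖∑ j, (β j - b s j) • v j‖ ≤ ∑ j, 1 / N * ‖v j‖ := by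
          refine norm_sum_le_of_le _ fun j _ => ?_
          rw [norm_smul]
          exact mul_le_mul_of_nonneg_right (hdj j) (norm_nonneg _)
      _ = (∑ j, ‖v j‖) / N := by rw [← Finset.mul_sum]; ring
      _ ≤ 1 := by rw [div_le_one hN0, hN]; linarith [(Nat.cast_nonneg n : (0:ℝ) ≤ n)]
  have h2 : ∀ k, ‖∑ j, b s j * z j k‖ ≤ ‖∑ j, β j * z j k‖ + 1 := by
    intro k
    have e : ∑ j, b s j * z j k = ∑ j, β j * z j k - ∑ j, (β j - b s j) * z j k := by
      rw [← Finset.sum_sub_distrib]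
      exact Finset.sum_congr rfl fun j _ => by ring
    rw [e]
    refine (norm_sub_le _ _).trans (add_le_add le_rfl ?_)
    calc ‖∑ j, (β j - b s j) * z j k‖ ≤ ∑ j : Fin n, 1 / N * 1 := by
          refine norm_sum_le_of_le _ fun j _ => ?_
          rw [norm_mul]
          exact mul_le_mul (hdj j) (hz j k) (norm_nonneg _) (by positivity)
      _ = n / N := by simp; ring
      _ ≤ 1 := by rw [div_le_one hN0, hN]; linarith
  have h3 : ∀ k, ‖∑ j, b s j * z j k‖ ^ q ≤ 2 ^ q * (‖∑ j, β j * z j k‖ ^ q + 1) := by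
    intro k
    refine (Real.rpow_le_rpow (norm_nonneg _) (h2 k) hq0.le).trans ?_
    simpa using aux_add_rpow (norm_nonneg (∑ j, β j * z j k)) zero_le_one hq
  have h4 : ‖∑ j, β j • v j‖ ^ q ≤ 2 ^ q * (‖∑ j, b s j • v j‖ ^ q + 1) := by
    refine (Real.rpow_le_rpow (norm_nonneg _) h1 hq0.le).trans ?_
    simpa using aux_add_rpow (norm_nonneg (∑ j, b s j • v j)) zero_le_one hq
  set I := ∑ i, μ i * ‖∑ j, β j * z j (κ i)‖ ^ q with hI
  have hI0 : 0 ≤ I := Finset.sum_nonneg fun i _ => mul_nonneg (hμ0 i) (by positivity)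
  have h5 : ∑ i, μ i * ‖∑ j, b s j * z j (κ i)‖ ^ q ≤ 2 ^ q * (I + 1) := by
    calc _ ≤ ∑ i, μ i * (2 ^ q * (‖∑ j, β j * z j (κ i)‖ ^ q + 1)) :=
          Finset.sum_le_sum fun i _ => mul_le_mul_of_nonneg_left (h3 _) (hμ0 i)
      _ = 2 ^ q * (I + ∑ i, μ i) := by
          rw [hI, ← Finset.sum_add_distrib, Finset.mul_sum]
          exact Finset.sum_congr rfl fun i _ => by ring
      _ = _ := by rw [hμ1]
  have h6 := hdom s
  calc _ ≤ 2 ^ q * ((D * (2 ^ q * (I + 1)) + 1) + 1) := by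
        refine h4.trans ?_
        gcongr
        exact h6.trans (by gcongr)
    _ ≤ _ := by
      rw [mul_assoc]
      gcongr
      nlinarith

theorem aux_dual {𝕜 : Type*} [RCLike 𝕜] {X : Type*} [NormedAddCommGroup X] [NormedSpace 𝕜 X]
    {n : ℕ} (y : Fin n → X) {p p' L : ℝ} (hpp : p.HolderConjugate p')
    (h : ∀ α : Fin n → 𝕜, ∑ j, ‖α j‖ ^ p' ≤ 1 → ‖∑ j, α j • y j‖ ≤ L)
    (φ : X →L[𝕜] 𝕜) (hφ : ‖φ‖ ≤ 1) : ∑ j, ‖φ (y j)‖ ^ p ≤ L ^ p := by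
  obtain ⟨g, hg, hge⟩ := (NNReal.isGreatest_Lp Finset.univ (fun j => ‖φ (y j)‖₊) hpp).1
  choose c hc1 hc2 using fun j => RCLike.exists_norm_eq_mul_self (φ (y j))
  have hge' : ∑ j, ‖φ (y j)‖ * (g j : ℝ) = (∑ j, ‖φ (y j)‖ ^ p) ^ (1 / p) := by
    have := congrArg NNReal.toReal hge
    push_cast at this
    simpa using this
  have hg' : ∑ j, (g j : ℝ) ^ p' ≤ 1 := by exact_mod_cast hg
  have hn : ∀ j, ‖((g j : ℝ) : 𝕜) * c j‖ = g j := by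
    intro j; rw [norm_mul, hc1, mul_one, RCLike.norm_ofReal, abs_of_nonneg (g j).coe_nonneg]
  have h1 := h (fun j => ((g j : ℝ) : 𝕜) * c j) (by simpa only [hn] using hg')
  have h2 : ‖φ (∑ j, (((g j : ℝ) : 𝕜) * c j) • y j)‖ ≤ L :=
    (φ.le_opNorm _).trans ((mul_le_of_le_one_left (norm_nonneg _) hφ).trans h1)
  have e : φ (∑ j, (((g j : ℝ) : 𝕜) * c j) • y j) = ((∑ j, ‖φ (y j)‖ * (g j : ℝ) : ℝ) : 𝕜) := by
    rw [map_sum]; push_cast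
    refine Finset.sum_congr rfl fun j _ => ?_
    rw [map_smul, smul_eq_mul, mul_assoc, ← hc2 j, mul_comm]
  rw [e, RCLike.norm_ofReal, hge'] at h2
  have hS : 0 ≤ ∑ j, ‖φ (y j)‖ ^ p := Finset.sum_nonneg fun _ _ => by positivity
  rw [abs_of_nonneg (by positivity)] at h2
  have := Real.rpow_le_rpow (by positivity) h2 hpp.nonneg
  rwa [← Real.rpow_mul hS, one_div_mul_cancel hpp.ne_zero, Real.rpow_one] at this

/-- Power form of absolute summability. -/
def AuxSum (𝕜 : Type*) [RCLike 𝕜] {X Y : Type*} [NormedAddCommGroup X] [NormedSpace 𝕜 X]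
    [NormedAddCommGroup Y] [NormedSpace 𝕜 Y] (p : ℝ) (u : X →L[𝕜] Y) (D : ℝ) : Prop :=
  ∀ (n : ℕ) (x : Fin n → X) (B : ℝ), 0 < B →
    (∀ φ : X →L[𝕜] 𝕜, ‖φ‖ ≤ 1 → ∑ j, ‖φ (x j)‖ ^ p ≤ B) → ∑ j, ‖u (x j)‖ ^ p ≤ D * B

theorem aux_inclusion {𝕜 : Type*} [RCLike 𝕜] {X Y : Type*} [NormedAddCommGroup X] [NormedSpace 𝕜 X]
    [NormedAddCommGroup Y] [NormedSpace 𝕜 Y] {p s : ℝ} (hp : 1 ≤ p) (hps : p ≤ s)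
    (u : X →L[𝕜] Y) {D : ℝ} (hD : 0 < D) (hu : AuxSum 𝕜 p u D) :
    AuxSum 𝕜 s u (D ^ (s / p)) := by
  intro n x B hB hx
  have hp0 : 0 < p := by linarith
  have hs0 : 0 < s := by linarith
  set Q := ∑ j, ‖u (x j)‖ ^ s with hQ
  have hQ0 : 0 ≤ Q := Finset.sum_nonneg fun _ _ => by positivity
  rcases hQ0.eq_or_lt with h0 | h0
  · rw [← h0]; positivity
  have hps1 : p / s ≤ 1 := (div_le_one hs0).2 hps
  let l : Fin n → ℝ := fun j => (‖u (x j)‖ ^ s) ^ ((1 - p / s) / p)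
  have hl : ∀ j, 0 ≤ l j := fun j => by positivity
  have hlp : ∀ j, l j ^ p = (‖u (x j)‖ ^ s) ^ (1 - p / s) := by
    intro j
    simp only [l]
    rw [← Real.rpow_mul (by positivity), div_mul_cancel₀ _ hp0.ne']
  have hsp : ∀ a : ℝ, 0 ≤ a → a ^ p = (a ^ s) ^ (p / s) := by
    intro a ha
    rw [← Real.rpow_mul ha, mul_div_cancel₀ _ hs0.ne']
  have key := hu n (fun j => ((l j : ℝ) : 𝕜) • x j) (Q ^ (1 - p / s) * B ^ (p / s)) (by positivity) (by
    intro φ hφ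
    refine le_trans (le_of_eq ?_) (aux_holder2 (fun j => ‖u (x j)‖ ^ s) (fun j => ‖φ (x j)‖ ^ s)
      (fun _ => by positivity) (fun _ => by positivity) h0 hB (w₁ := 1 - p / s) (w₂ := p / s)
      (by linarith) (by positivity) (by ring) hQ.ge (hx φ hφ))
    refine Finset.sum_congr rfl fun j _ => ?_
    rw [map_smul, norm_smul, RCLike.norm_ofReal, abs_of_nonneg (hl j),
      Real.mul_rpow (hl j) (norm_nonneg _), hlp, hsp _ (norm_nonneg (φ (x j)))])
  have e : ∑ j, ‖u (((l j : ℝ) : 𝕜) • x j)‖ ^ p = Q := by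
    refine Finset.sum_congr rfl fun j _ => ?_
    rw [map_smul, norm_smul, RCLike.norm_ofReal, abs_of_nonneg (hl j),
      Real.mul_rpow (hl j) (norm_nonneg _), hlp, hsp _ (norm_nonneg (u (x j))),
      ← Real.rpow_add_of_nonneg (by positivity) (by linarith) (by positivity)]
    simp
  rw [e] at key
  have hQs : Q = Q ^ (1 - p / s) * Q ^ (p / s) := by
    rw [← Real.rpow_add h0]; simp
  have hQp : 0 < Q ^ (1 - p / s) := by positivity
  have h1 : Q ^ (p / s) ≤ D * B ^ (p / s) := by
    rw [← mul_le_mul_iff_right₀ hQp, ← hQs]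
    linarith
  have h2 := Real.rpow_le_rpow (by positivity) h1 (z := s / p) (by positivity)
  rwa [← Real.rpow_mul hQ0, Real.mul_rpow hD.le (by positivity), ← Real.rpow_mul hB.le,
    div_mul_div_cancel₀ hs0.ne', div_self hp0.ne', Real.rpow_one, Real.rpow_one] at h2

theorem aux_pointwise {a z t p p' q r : ℝ} (ha : 0 ≤ a) (hz : 0 ≤ z) (ht : 0 < t)
    (hpp : p.HolderConjugate p') (hq : 1 ≤ q) (hr1 : 1 ≤ r) (hr : 1 / r = 1 / p + 1 / q) :
    a * t ^ (-(1 / q)) * z =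
      (a ^ p' * z ^ r / t) ^ (1 / q) * (z ^ r) ^ (1 / p) * (a ^ p') ^ (1 - 1 / r) := by
  have hp0 := hpp.pos
  have hp'0 := hpp.symm.pos
  have hq0 : 0 < q := by linarith
  have hr0 : 0 < r := by linarith
  have hrle : 1 / r ≤ 1 := by rw [div_le_one hr0]; exact hr1
  rw [Real.div_rpow (by positivity) ht.le, Real.mul_rpow (by positivity) (by positivity),
    ← Real.rpow_mul ha, ← Real.rpow_mul ha, ← Real.rpow_mul hz, ← Real.rpow_mul hz,
    Real.rpow_neg ht.le]
  have e1 : z ^ (r * (1 / q)) * z ^ (r * (1 / p)) = z := by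
    rw [← Real.rpow_add_of_nonneg hz (by positivity) (by positivity), ← mul_add,
      add_comm, ← hr, mul_one_div_cancel hr0.ne', Real.rpow_one]
  have hpi := hpp.inv_add_inv_eq_one
  have e2 : a ^ (p' * (1 / q)) * a ^ (p' * (1 - 1 / r)) = a := by
    rw [← Real.rpow_add_of_nonneg ha (by positivity) (mul_nonneg hp'0.le (by linarith)), ← mul_add]
    have : 1 / q + (1 - 1 / r) = p'⁻¹ := by
      rw [hr, one_div, one_div]; linarith
    rw [this, mul_inv_cancel₀ hp'0.ne', Real.rpow_one]
  calc a * (t ^ (1 / q))⁻¹ * z = (a ^ (p' * (1 / q)) * a ^ (p' * (1 - 1 / r))) * (t ^ (1 / q))⁻¹ *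
        (z ^ (r * (1 / q)) * z ^ (r * (1 / p))) := by rw [e1, e2]
    _ = _ := by ring

theorem aux_main {𝕜 : Type*} [RCLike 𝕜] {X Y : Type*} [NormedAddCommGroup X] [NormedSpace 𝕜 X]
    [NormedAddCommGroup Y] [NormedSpace 𝕜 Y]
    {K : Type*} [Nonempty K] {n : ℕ} (v : Fin n → X) (z : Fin n → K → 𝕜)
    {p q r D E : ℝ} (hp : 1 < p) (hq : 1 ≤ q) (hr1 : 1 ≤ r) (hr : 1 / r = 1 / p + 1 / q)
    (hD : 0 < D) (hE : 0 < E) (u : X →L[𝕜] Y) (hu : AuxSum 𝕜 p u E)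
    (H : ∀ (S : Type) [Fintype S] (β : S → Fin n → 𝕜) (B : ℝ), 0 ≤ B →
      (∀ k, ∑ s, ‖∑ j, β s j * z j k‖ ^ q ≤ B) → ∑ s, ‖∑ j, β s j • v j‖ ^ q ≤ D * B)
    (hz : ∀ k, ∑ j, ‖z j k‖ ^ r ≤ 1) :
    ∑ j, ‖u (v j)‖ ^ r ≤ 2 ^ (r / q) *
      (E * (((2 ^ q * (D * 2 ^ q + 2)) * 3) ^ (1 / q)) ^ p) ^ (r / p) := by
  have hq0 : 0 < q := by linarith
  have hp0 : 0 < p := by linarith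
  have hr0 : 0 < r := by linarith
  have hrle : 1 / r ≤ 1 := by rw [div_le_one hr0]; exact hr1
  have hpp : p.HolderConjugate p.conjExponent := .conjExponent hp
  set p' := p.conjExponent
  have hp'0 : 0 < p' := hpp.symm.pos
  have hz1 : ∀ j k, ‖z j k‖ ≤ 1 := by
    intro j k
    have h1 : ‖z j k‖ ^ r ≤ 1 := le_trans (Finset.single_le_sum
      (f := fun j => ‖z j k‖ ^ r) (fun j _ => by positivity) (Finset.mem_univ j)) (hz k)
    by_contra h
    push Not at h
    have := Real.one_lt_rpow h hr0
    linarith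
  obtain ⟨ι, _, μ, κ, hμ0, hμ1, hdom⟩ :=
    aux_dom_ball v z hz1 (R := ((n : ℝ) + 1) ^ (1 / q)) hq hD H
  set D1 := 2 ^ q * (D * 2 ^ q + 2) with hD1
  have hD1p : 0 < D1 := by positivity
  let t : Fin n → ℝ := fun j => ∑ i, μ i * ‖z j (κ i)‖ ^ r + 1 / ((n : ℝ) + 1)
  have hI0 : ∀ j, 0 ≤ ∑ i, μ i * ‖z j (κ i)‖ ^ r := fun j =>
    Finset.sum_nonneg fun i _ => mul_nonneg (hμ0 i) (by positivity)
  have hn1 : (0:ℝ) < (n:ℝ) + 1 := by positivity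
  have htlow : ∀ j, 1 / ((n : ℝ) + 1) ≤ t j := fun j => by simp only [t]; linarith [hI0 j]
  have ht0 : ∀ j, 0 < t j := fun j => lt_of_lt_of_le (by positivity) (htlow j)
  have hts : ∑ j, t j ≤ 2 := by
    simp only [t]
    rw [Finset.sum_add_distrib, Finset.sum_comm]
    have h1 : ∑ i, ∑ j, μ i * ‖z j (κ i)‖ ^ r ≤ 1 := by
      rw [← hμ1]
      refine Finset.sum_le_sum fun i _ => ?_
      rw [← Finset.mul_sum]
      exact mul_le_of_le_one_right (hμ0 i) (hz _)
    have h2 : ∑ _j : Fin n, 1 / ((n : ℝ) + 1) ≤ 1 := by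
      simp only [Finset.sum_const, Finset.card_univ, Fintype.card_fin, nsmul_eq_mul]
      rw [mul_one_div, div_le_one hn1]; linarith
    linarith
  let τ : Fin n → ℝ := fun j => t j ^ (-(1 / q))
  have hτ0 : ∀ j, 0 < τ j := fun j => Real.rpow_pos_of_pos (ht0 j) _
  have hτR : ∀ j, τ j ≤ ((n : ℝ) + 1) ^ (1 / q) := by
    intro j
    simp only [τ]
    rw [Real.rpow_neg (ht0 j).le, ← Real.inv_rpow (ht0 j).le]
    refine Real.rpow_le_rpow (inv_nonneg.2 (ht0 j).le) ?_ (by positivity)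
    rw [inv_le_comm₀ (ht0 j) hn1, ← one_div]
    exact htlow j
  let y : Fin n → X := fun j => ((τ j : ℝ) : 𝕜) • v j
  have hweak : ∀ α : Fin n → 𝕜, ∑ j, ‖α j‖ ^ p' ≤ 1 → ‖∑ j, α j • y j‖ ≤ (D1 * 3) ^ (1 / q) := by
    intro α hα
    have hα1 : ∀ j, ‖α j‖ ≤ 1 := by
      intro j
      have h1 : ‖α j‖ ^ p' ≤ 1 := le_trans (Finset.single_le_sum
        (f := fun j => ‖α j‖ ^ p') (fun j _ => by positivity) (Finset.mem_univ j)) hα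
      by_contra h
      push Not at h
      have := Real.one_lt_rpow h hp'0
      linarith
    have hnβ : ∀ j, ‖α j * ((τ j : ℝ) : 𝕜)‖ = ‖α j‖ * τ j := by
      intro j; rw [norm_mul, RCLike.norm_ofReal, abs_of_pos (hτ0 j)]
    have h1 := hdom (fun j => α j * ((τ j : ℝ) : 𝕜)) (by
      intro j
      rw [hnβ]
      exact (mul_le_of_le_one_left (hτ0 j).le (hα1 j)).trans (hτR j))
    have e1 : ∑ j, (α j * ((τ j : ℝ) : 𝕜)) • v j = ∑ j, α j • y j :=
      Finset.sum_congr rfl fun j _ => by simp only [y]; rw [mul_smul]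
    rw [e1] at h1
    have hpt : ∀ k, ‖∑ j, α j * ((τ j : ℝ) : 𝕜) * z j k‖ ^ q ≤
        (∑ j, ‖α j‖ ^ p' * ‖z j k‖ ^ r / t j) + 1 := by
      intro k
      have hS0 : 0 ≤ ∑ j, ‖α j‖ ^ p' * ‖z j k‖ ^ r / t j := Finset.sum_nonneg fun j _ => by
        have := ht0 j; positivity
      have h2 : ‖∑ j, α j * ((τ j : ℝ) : 𝕜) * z j k‖ ≤
          ((∑ j, ‖α j‖ ^ p' * ‖z j k‖ ^ r / t j) + 1) ^ (1 / q) := by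
        calc _ ≤ ∑ j, ‖α j‖ * t j ^ (-(1 / q)) * ‖z j k‖ := by
              refine norm_sum_le_of_le _ fun j _ => ?_
              rw [norm_mul, hnβ]
          _ = ∑ j, (‖α j‖ ^ p' * ‖z j k‖ ^ r / t j) ^ (1 / q) * (‖z j k‖ ^ r) ^ (1 / p) *
                (‖α j‖ ^ p') ^ (1 - 1 / r) :=
              Finset.sum_congr rfl fun j _ =>
                aux_pointwise (norm_nonneg _) (norm_nonneg _) (ht0 j) hpp hq hr1 hr
          _ ≤ ((∑ j, ‖α j‖ ^ p' * ‖z j k‖ ^ r / t j) + 1) ^ (1 / q) * 1 ^ (1 / p) *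
                1 ^ (1 - 1 / r) := by
              refine aux_holder3 _ _ _ (fun j => ?_) (fun j => by positivity)
                (fun j => by positivity) (by linarith) one_pos one_pos (by positivity)
                (by positivity) (by linarith) (by rw [hr]; ring) (by linarith) (hz k) hα
              have := ht0 j
              positivity
          _ = _ := by simp
      have h3 := Real.rpow_le_rpow (norm_nonneg _) h2 hq0.le
      rwa [← Real.rpow_mul (by linarith), one_div_mul_cancel hq0.ne', Real.rpow_one] at h3
    have hintegral : ∑ i, μ i * ‖∑ j, α j * ((τ j : ℝ) : 𝕜) * z j (κ i)‖ ^ q ≤ 2 := by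
      calc _ ≤ ∑ i, μ i * ((∑ j, ‖α j‖ ^ p' * ‖z j (κ i)‖ ^ r / t j) + 1) :=
            Finset.sum_le_sum fun i _ => mul_le_mul_of_nonneg_left (hpt _) (hμ0 i)
        _ = ∑ j, ‖α j‖ ^ p' * ((∑ i, μ i * ‖z j (κ i)‖ ^ r) / t j) + 1 := by
            simp_rw [mul_add, mul_one]
            rw [Finset.sum_add_distrib, hμ1]
            congr 1
            simp_rw [Finset.sum_div, Finset.mul_sum]
            rw [Finset.sum_comm]
            exact Finset.sum_congr rfl fun j _ => Finset.sum_congr rfl fun i _ => by ring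
        _ ≤ ∑ j, ‖α j‖ ^ p' + 1 := by
            gcongr with j _
            refine mul_le_of_le_one_right (by positivity) ?_
            rw [div_le_one (ht0 j)]
            simp only [t]
            have : 0 ≤ 1 / ((n : ℝ) + 1) := by positivity
            linarith
        _ ≤ 2 := by linarith
    have h4 : ‖∑ j, α j • y j‖ ^ q ≤ D1 * 3 := h1.trans (by gcongr; linarith)
    have h5 := Real.rpow_le_rpow (by positivity) h4 (z := 1 / q) (by positivity)
    rwa [← Real.rpow_mul (norm_nonneg _), mul_one_div_cancel hq0.ne', Real.rpow_one] at h5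
  have huy := hu n y ((((D1 * 3) ^ (1 / q))) ^ p) (by positivity)
    (fun φ hφ => aux_dual y hpp hweak φ hφ)
  have hw : r / q + r / p = 1 := by
    have : r / q + r / p = r * (1 / p + 1 / q) := by ring
    rw [this, ← hr, mul_one_div_cancel hr0.ne']
  refine le_trans (le_of_eq ?_) (aux_holder2 t (fun j => ‖u (y j)‖ ^ p) (fun j => (ht0 j).le)
    (fun j => by positivity) two_pos (by positivity) (by positivity) (by positivity) hw hts huy)
  refine Finset.sum_congr rfl fun j _ => ?_
  simp only [y]
  rw [map_smul, norm_smul, RCLike.norm_ofReal, abs_of_pos (hτ0 j),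
    ← Real.rpow_mul (by have := hτ0 j; positivity), mul_div_cancel₀ _ hp0.ne',
    Real.mul_rpow (hτ0 j).le (norm_nonneg _), ← mul_assoc]
  simp only [τ]
  rw [← Real.rpow_mul (ht0 j).le, ← Real.rpow_add (ht0 j)]
  have : r / q + -(1 / q) * r = 0 := by ring
  rw [this, Real.rpow_zero, one_mul]

theorem aux_sum_of_bound {𝕜 : Type*} [RCLike 𝕜] {X Y : Type*} [NormedAddCommGroup X]
    [NormedSpace 𝕜 X] [NormedAddCommGroup Y] [NormedSpace 𝕜 Y] {p C : ℝ} (hp : 1 ≤ p)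
    (u : X →L[𝕜] Y) (hu : AbsSummingBound 𝕜 p u C) : AuxSum 𝕜 p u (C ^ p + 1) := by
  intro n x B hB hx
  have hp0 : 0 < p := by linarith
  obtain ⟨hC, hu⟩ := hu
  have : Nonempty {φ : X →L[𝕜] 𝕜 // ‖φ‖ ≤ 1} := ⟨⟨0, by simp⟩⟩
  have h1 : (∑ j, ‖u (x j)‖ ^ p) ^ (1 / p) ≤ C * B ^ (1 / p) := by
    refine (hu n x).trans (mul_le_mul_of_nonneg_left ?_ hC)
    refine ciSup_le fun φ => ?_
    exact Real.rpow_le_rpow (Finset.sum_nonneg fun _ _ => by positivity) (hx φ.1 φ.2) (by positivity)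
  have hS : 0 ≤ ∑ j, ‖u (x j)‖ ^ p := Finset.sum_nonneg fun _ _ => by positivity
  have h2 := Real.rpow_le_rpow (by positivity) h1 hp0.le
  rw [← Real.rpow_mul hS, one_div_mul_cancel hp0.ne', Real.rpow_one,
    Real.mul_rpow hC (by positivity), ← Real.rpow_mul hB.le, one_div_mul_cancel hp0.ne',
    Real.rpow_one] at h2
  linarith

theorem aux_poly_bound {𝕜 : Type*} [RCLike 𝕜] {G : Type*} [NormedAddCommGroup G] [NormedSpace 𝕜 G]
    {m : ℕ} {f : G → 𝕜} (hf : IsHomogPoly 𝕜 m f) (hf1 : polyNorm f ≤ 1) (x : G) :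
    ‖f x‖ ≤ (‖x‖ + 1) ^ m := by
  obtain ⟨T, hT⟩ := hf
  have hbdd : BddAbove (Set.range fun x : {x : G // ‖x‖ ≤ 1} => ‖f x.1‖) := by
    refine ⟨‖T‖, ?_⟩
    rintro _ ⟨x, rfl⟩
    simp only [hT]
    refine (T.le_opNorm _).trans (mul_le_of_le_one_right (norm_nonneg _) ?_)
    exact Finset.prod_le_one (fun _ _ => norm_nonneg _) fun _ _ => x.2
  have hc : (0:ℝ) < ‖x‖ + 1 := by positivity
  set y : G := (((‖x‖ + 1)⁻¹ : ℝ) : 𝕜) • x with hy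
  have hy1 : ‖y‖ ≤ 1 := by
    rw [hy, norm_smul, RCLike.norm_ofReal, abs_of_pos (by positivity), inv_mul_le_one₀ hc]
    linarith
  have h1 : ‖f y‖ ≤ 1 := (le_ciSup hbdd ⟨y, hy1⟩).trans hf1
  have hxy : x = ((‖x‖ + 1 : ℝ) : 𝕜) • y := by
    rw [hy, smul_smul, ← RCLike.ofReal_mul, mul_inv_cancel₀ hc.ne', RCLike.ofReal_one, one_smul]
  have h2 : f x = ((‖x‖ + 1 : ℝ) : 𝕜) ^ m * f y := by
    have := T.map_smul_univ (fun _ => ((‖x‖ + 1 : ℝ) : 𝕜)) (fun _ => y)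
    rw [Finset.prod_const, Finset.card_univ, Fintype.card_fin, ← hxy, ← hT, ← hT] at this
    exact this
  rw [h2, norm_mul, norm_pow, RCLike.norm_ofReal, abs_of_pos hc]
  exact mul_le_of_le_one_right (by positivity) h1

theorem aux_H {𝕜 : Type*} [RCLike 𝕜] {G X : Type*} [NormedAddCommGroup G] [NormedSpace 𝕜 G]
    [NormedAddCommGroup X] [NormedSpace 𝕜 X] {m : ℕ} {q C : ℝ} (hq : 1 ≤ q) (P : G → X)
    (hP : FactStronglySummingPolyBound 𝕜 m q P C)
    [Nonempty {q : G → 𝕜 // IsHomogPoly 𝕜 m q ∧ polyNorm q ≤ 1}]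
    (n m₂ : ℕ) (x : Fin n → Fin m₂ → G) (lam : Fin n → Fin m₂ → 𝕜)
    (S : Type) [Fintype S] (β : S → Fin n → 𝕜) (B : ℝ) (hB : 0 ≤ B)
    (h : ∀ k : {q : G → 𝕜 // IsHomogPoly 𝕜 m q ∧ polyNorm q ≤ 1},
      ∑ s, ‖∑ j, β s j * ∑ i, lam j i • k.1 (x j i)‖ ^ q ≤ B) :
    ∑ s, ‖∑ j, β s j • ∑ i, lam j i • P (x j i)‖ ^ q ≤ (C ^ q + 1) * B := by
  have hq0 : 0 < q := by linarith
  obtain ⟨hC, hP⟩ := hP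
  let e := (Fintype.equivFin S).symm
  have hgen : ∀ (Z : Type _) [NormedAddCommGroup Z] [NormedSpace 𝕜 Z] (f : G → Z),
      ∑ s : Fin (Fintype.card S), ‖∑ l : Fin (n * m₂),
        (β (e s) (finProdFinEquiv.symm l).1 *
          lam (finProdFinEquiv.symm l).1 (finProdFinEquiv.symm l).2) •
          f (x (finProdFinEquiv.symm l).1 (finProdFinEquiv.symm l).2)‖ ^ q =
      ∑ s, ‖∑ j, β s j • ∑ i, lam j i • f (x j i)‖ ^ q := by
    intro Z _ _ f
    rw [← Equiv.sum_comp e]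
    refine Finset.sum_congr rfl fun s _ => ?_
    congr 2
    rw [Equiv.sum_comp finProdFinEquiv.symm (fun l : Fin n × Fin m₂ =>
      (β (e s) l.1 * lam l.1 l.2) • f (x l.1 l.2)), Fintype.sum_prod_type]
    refine Finset.sum_congr rfl fun j _ => ?_
    rw [Finset.smul_sum]
    exact Finset.sum_congr rfl fun i _ => mul_smul _ _ _
  have hgen' : ∀ (f : G → 𝕜),
      ∑ s : Fin (Fintype.card S), ‖∑ l : Fin (n * m₂),
        (β (e s) (finProdFinEquiv.symm l).1 *
          lam (finProdFinEquiv.symm l).1 (finProdFinEquiv.symm l).2) •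
          f (x (finProdFinEquiv.symm l).1 (finProdFinEquiv.symm l).2)‖ ^ q =
      ∑ s, ‖∑ j, β s j • ∑ i, lam j i • f (x j i)‖ ^ q := by
    intro f
    rw [← Equiv.sum_comp e]
    refine Finset.sum_congr rfl fun s _ => ?_
    congr 2
    rw [Equiv.sum_comp finProdFinEquiv.symm (fun l : Fin n × Fin m₂ =>
      (β (e s) l.1 * lam l.1 l.2) • f (x l.1 l.2)), Fintype.sum_prod_type]
    refine Finset.sum_congr rfl fun j _ => ?_
    rw [Finset.smul_sum]
    exact Finset.sum_congr rfl fun i _ => mul_smul _ _ _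
  have h1 := hP (Fintype.card S) (n * m₂)
    (fun _ l => x (finProdFinEquiv.symm l).1 (finProdFinEquiv.symm l).2)
    (fun s l => β (e s) (finProdFinEquiv.symm l).1 *
      lam (finProdFinEquiv.symm l).1 (finProdFinEquiv.symm l).2)
  rw [hgen X P] at h1
  have h2 : (∑ s, ‖∑ j, β s j • ∑ i, lam j i • P (x j i)‖ ^ q) ^ (1 / q) ≤ C * B ^ (1 / q) := by
    refine h1.trans (mul_le_mul_of_nonneg_left ?_ hC)
    refine ciSup_le fun k => ?_
    rw [hgen' k.1]
    exact Real.rpow_le_rpow (Finset.sum_nonneg fun _ _ => by positivity) (h k) (by positivity)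
  have hS : 0 ≤ ∑ s, ‖∑ j, β s j • ∑ i, lam j i • P (x j i)‖ ^ q :=
    Finset.sum_nonneg fun _ _ => by positivity
  have h3 := Real.rpow_le_rpow (by positivity) h2 hq0.le
  rw [← Real.rpow_mul hS, one_div_mul_cancel hq0.ne', Real.rpow_one,
    Real.mul_rpow hC (by positivity), ← Real.rpow_mul hB, one_div_mul_cancel hq0.ne',
    Real.rpow_one] at h3
  linarith

/-- Composition Theorem: if `u` is absolutely `p`-summing and `P` is a
factorable strongly `q`-summing `m`-homogeneous polynomial, then `u ∘ P` is factorable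
strongly `r`-summing, where `1/r = min{1, 1/p + 1/q}`. -/
theorem composition_factStronglySummingPoly
    {𝕜 : Type*} [RCLike 𝕜] {G X Y : Type*}
    [NormedAddCommGroup G] [NormedSpace 𝕜 G] [CompleteSpace G]
    [NormedAddCommGroup X] [NormedSpace 𝕜 X] [CompleteSpace X]
    [NormedAddCommGroup Y] [NormedSpace 𝕜 Y] [CompleteSpace Y]
    (m : ℕ) (p q r : ℝ) (hp : 1 ≤ p) (hq : 1 ≤ q)
    (hr : 1 / r = min 1 (1 / p + 1 / q))
    (u : X →L[𝕜] Y) (hu : AbsolutelySumming 𝕜 p u)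
    (P : G → X) (hP : FactStronglySummingPoly 𝕜 m q P) :
    FactStronglySummingPoly 𝕜 m r (fun x => u (P x)) := by
  have hp0 : 0 < p := by linarith
  have hq0 : 0 < q := by linarith
  have hr0 : 0 < r := by
    have : 0 < 1 / r := by rw [hr]; positivity
    exact one_div_pos.1 this
  have hr1 : 1 ≤ r := by
    have : 1 / r ≤ 1 := by rw [hr]; exact min_le_left _ _
    rwa [div_le_one hr0] at this
  obtain ⟨⟨T, hT⟩, C, hPC⟩ := hP
  obtain ⟨Cu, hu⟩ := hu
  have hC := hPC.1
  have hCu := hu.1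
  have hD : 0 < C ^ q + 1 := by positivity
  have hE : 0 < Cu ^ p + 1 := by positivity
  have hu' := aux_sum_of_bound hp u hu
  have hne : Nonempty {q : G → 𝕜 // IsHomogPoly 𝕜 m q ∧ polyNorm q ≤ 1} :=
    ⟨⟨fun _ => 0, ⟨0, fun _ => rfl⟩, by simp [polyNorm]⟩⟩
  refine ⟨⟨u.compContinuousMultilinearMap T, fun x => by simp [hT]⟩, ?_⟩
  -- normalized estimate
  have hmain : ∃ F : ℝ, 0 ≤ F ∧ ∀ (n m₂ : ℕ) (x : Fin n → Fin m₂ → G) (lam : Fin n → Fin m₂ → 𝕜),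
      (∀ k : {q : G → 𝕜 // IsHomogPoly 𝕜 m q ∧ polyNorm q ≤ 1},
        ∑ j, ‖∑ i, lam j i • k.1 (x j i)‖ ^ r ≤ 1) →
      ∑ j, ‖u (∑ i, lam j i • P (x j i))‖ ^ r ≤ F := by
    rcases le_or_gt (1 / p + 1 / q) 1 with hle | hgt
    · rw [min_eq_right hle] at hr
      have hp1 : 1 < p := by
        rcases hp.eq_or_lt with h | h
        · exfalso
          rw [← h] at hle
          have : 0 < 1 / q := by positivity
          norm_num at hle
          linarith
        · exact h
      exact ⟨_, by positivity, fun n m₂ x lam hk => aux_main (fun j => ∑ i, lam j i • P (x j i))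
        (fun j (k : {q : G → 𝕜 // IsHomogPoly 𝕜 m q ∧ polyNorm q ≤ 1}) =>
          ∑ i, lam j i • k.1 (x j i)) hp1 hq hr1 hr hD hE u hu'
        (fun S _ β B hB h => aux_H hq P hPC n m₂ x lam S β B hB h) hk⟩
    · rw [min_eq_left hgt.le] at hr
      have hre : r = 1 := by
        have := hr
        field_simp at this
        linarith
      subst hre
      rcases hq.eq_or_lt with hq1 | hq1
      · subst hq1
        refine ⟨‖u‖ * ((C ^ (1:ℝ) + 1) * 1), by positivity, fun n m₂ x lam hk => ?_⟩
        have h1 := aux_H hq P hPC n m₂ x lam (Fin n) (fun s j => if j = s then 1 else 0) 1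
          zero_le_one (fun k => by simpa using hk k)
        have h2 : ∑ j, ‖∑ i, lam j i • P (x j i)‖ ^ (1:ℝ) ≤ (C ^ (1:ℝ) + 1) * 1 := by
          simpa using h1
        refine le_trans ?_ (mul_le_mul_of_nonneg_left h2 (norm_nonneg u))
        rw [Finset.mul_sum]
        refine Finset.sum_le_sum fun j _ => ?_
        simp only [Real.rpow_one]
        exact u.le_opNorm _
      · have hqs : q.HolderConjugate q.conjExponent := .conjExponent hq1
        set s := q.conjExponent
        have hs1 : 1 < s := hqs.symm.lt
        have hsum := hqs.inv_add_inv_eq_one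
        have hps : p ≤ s := by
          have : s⁻¹ ≤ p⁻¹ := by
            rw [one_div, one_div] at hgt; linarith
          exact (inv_le_inv₀ (by linarith) hp0).1 this
        have hu'' := aux_inclusion hp hps u hE hu'
        have hE' : 0 < (Cu ^ p + 1) ^ (s / p) := by positivity
        have hr' : 1 / (1:ℝ) = 1 / s + 1 / q := by
          rw [one_div s, one_div q]; linarith
        have hs0 : 0 < s := by linarith
        exact ⟨_, by positivity, fun n m₂ x lam hk => aux_main (fun j => ∑ i, lam j i • P (x j i))
          (fun j (k : {q : G → 𝕜 // IsHomogPoly 𝕜 m q ∧ polyNorm q ≤ 1}) =>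
            ∑ i, lam j i • k.1 (x j i)) hs1 hq le_rfl hr' hD hE' u hu''
          (fun S _ β B hB h => aux_H hq P hPC n m₂ x lam S β B hB h) hk⟩
  obtain ⟨F, hF, hmain⟩ := hmain
  refine ⟨F ^ (1 / r), by positivity, fun n m₂ x lam => ?_⟩
  set f : {q : G → 𝕜 // IsHomogPoly 𝕜 m q ∧ polyNorm q ≤ 1} → ℝ :=
    fun k => (∑ j, ‖∑ i, lam j i • k.1 (x j i)‖ ^ r) ^ (1 / r) with hf
  have hbdd : BddAbove (Set.range f) := by
    refine ⟨(∑ j, (∑ i, ‖lam j i‖ * (‖x j i‖ + 1) ^ m) ^ r) ^ (1 / r), ?_⟩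
    rintro _ ⟨k, rfl⟩
    simp only [hf]
    refine Real.rpow_le_rpow (Finset.sum_nonneg fun _ _ => by positivity) ?_ (by positivity)
    refine Finset.sum_le_sum fun j _ => Real.rpow_le_rpow (norm_nonneg _) ?_ hr0.le
    refine norm_sum_le_of_le _ fun i _ => ?_
    rw [norm_smul]
    exact mul_le_mul_of_nonneg_left (aux_poly_bound k.2.1 k.2.2 _) (norm_nonneg _)
  set M := ⨆ k, f k with hM
  have hM0 : 0 ≤ M := Real.iSup_nonneg fun k =>
    Real.rpow_nonneg (Finset.sum_nonneg fun _ _ => by positivity) _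
  have hscale : ∀ M' : ℝ, M < M' →
      (∑ j, ‖∑ i, lam j i • u (P (x j i))‖ ^ r) ^ (1 / r) ≤ F ^ (1 / r) * M' := by
    intro M' hM'
    have hM'0 : 0 < M' := lt_of_le_of_lt hM0 hM'
    have hnM : ‖((M'⁻¹ : ℝ) : 𝕜)‖ = M'⁻¹ := by
      rw [RCLike.norm_ofReal, abs_of_pos (inv_pos.2 hM'0)]
    have hMr : 0 < M' ^ r := by positivity
    have h1 := hmain n m₂ x (fun j i => ((M'⁻¹ : ℝ) : 𝕜) * lam j i) (by
      intro k
      have h2 : f k ≤ M' := (le_ciSup hbdd k).trans hM'.le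
      simp only [hf] at h2
      have hS : 0 ≤ ∑ j, ‖∑ i, lam j i • k.1 (x j i)‖ ^ r :=
        Finset.sum_nonneg fun _ _ => by positivity
      have h3 := Real.rpow_le_rpow (by positivity) h2 hr0.le
      rw [← Real.rpow_mul hS, one_div_mul_cancel hr0.ne', Real.rpow_one] at h3
      have e : ∑ j, ‖∑ i, (((M'⁻¹ : ℝ) : 𝕜) * lam j i) • k.1 (x j i)‖ ^ r =
          (M' ^ r)⁻¹ * ∑ j, ‖∑ i, lam j i • k.1 (x j i)‖ ^ r := by
        rw [Finset.mul_sum]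
        refine Finset.sum_congr rfl fun j _ => ?_
        simp_rw [mul_smul]
        rw [← Finset.smul_sum, norm_smul, hnM, Real.mul_rpow (by positivity) (norm_nonneg _),
          Real.inv_rpow hM'0.le]
      rw [e, inv_mul_le_one₀ hMr]
      exact h3)
    have e : ∑ j, ‖u (∑ i, (((M'⁻¹ : ℝ) : 𝕜) * lam j i) • P (x j i))‖ ^ r =
        (M' ^ r)⁻¹ * ∑ j, ‖∑ i, lam j i • u (P (x j i))‖ ^ r := by
      rw [Finset.mul_sum]
      refine Finset.sum_congr rfl fun j _ => ?_
      simp_rw [mul_smul]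
      rw [← Finset.smul_sum, map_smul, norm_smul, hnM,
        Real.mul_rpow (by positivity) (norm_nonneg _), Real.inv_rpow hM'0.le, map_sum]
      simp_rw [map_smul]
    rw [e, inv_mul_le_iff₀ hMr] at h1
    have h4 := Real.rpow_le_rpow (Finset.sum_nonneg fun _ _ => by positivity) h1
      (z := 1 / r) (by positivity)
    rwa [Real.mul_rpow hMr.le hF, ← Real.rpow_mul hM'0.le, mul_one_div_cancel hr0.ne',
      Real.rpow_one, mul_comm] at h4
  refine ge_of_tendsto (x := nhdsWithin M (Set.Ioi M)) (f := fun M' => F ^ (1 / r) * M') ?_ ?_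
  · exact ((continuous_const.mul continuous_id).tendsto M).mono_left nhdsWithin_le_nhds
  · filter_upwards [self_mem_nhdsWithin] with M' hM'
    exact hscale M' hM'
end

section
/- (Extrapolation type theorem) Let 1 < r < p < ∞, let m be a positive integer and let X be a Banach space. If every factorable strongly p-summing m-homogeneous polynomial from X to ℓ_p is factorable strongly r-summing (so that the classes P_{FSt,p}(^m X; ℓ_p) and P_{FSt,r}(^m X; ℓ_p) coincide), then for every Banach space Y every factorable strongly p-summing m-homogeneous polynomial from X to Y is factorable strongly 1-summing, i.e., P_{FSt,p}(^m X; Y) = P_{FSt,1}(^m X; Y). -/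
open scoped BigOperators
open MeasureTheory

open scoped ENNReal

/-- finitely supported probability measures -/
structure FM (Φ : Type*) where
  k : ℕ
  w : ℕ → ℝ
  φ : ℕ → Φ
  nonneg : ∀ i, 0 ≤ w i
  sum_eq : ∑ i ∈ Finset.range k, w i = 1

lemma fm_of_convexHull {Φ : Type*} {n : ℕ} (f : Φ → Fin n → ℝ) (c : Fin n → ℝ)
    (hc : c ∈ convexHull ℝ (Set.range f)) :
    ∃ μ : FM Φ, ∀ j, c j = ∑ i ∈ Finset.range μ.k, μ.w i * f (μ.φ i) j := by
  classical
  obtain ⟨ι, _, w, z, hw, hw1, hz, rfl⟩ := mem_convexHull_iff_exists_fintype.1 hc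
  choose ψ hψ using hz
  let e := Fintype.equivFin ι
  have hne : Nonempty ι := by
    by_contra hne
    rw [not_nonempty_iff] at hne
    simp at hw1
  obtain ⟨i0⟩ := hne
  let s : ℕ → ι := fun i => if h : i < Fintype.card ι then e.symm ⟨i, h⟩ else i0
  have key : ∀ F : ι → ℝ, ∑ i ∈ Finset.range (Fintype.card ι), F (s i) = ∑ i, F i := by
    intro F
    rw [Finset.sum_range, ← Equiv.sum_comp e.symm]
    refine Finset.sum_congr rfl fun i _ => ?_
    simp [s]
  refine ⟨⟨Fintype.card ι, fun i => w (s i), fun i => ψ (s i), fun i => hw _, ?_⟩, fun j => ?_⟩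
  · rw [key, hw1]
  · simp only
    rw [key (fun i => w i * f (ψ i) j)]
    simp [Finset.sum_apply, hψ]

lemma pietsch {Φ : Type*} [Nonempty Φ] {n : ℕ} (f : Φ → Fin n → ℝ) (hf : ∀ φ j, 0 ≤ f φ j)
    (g : Fin n → ℝ) (hg : ∀ j, 0 ≤ g j) (K : ℝ) (hK : 0 < K)
    (h : ∀ a : Fin n → ℝ, (∀ j, 0 ≤ a j) → ∀ t, (∀ φ, ∑ j, a j * f φ j ≤ t) →
      ∑ j, a j * g j ≤ K * t) :
    ∃ μ : FM Φ, ∀ j, g j ≤ 2 * K * ∑ i ∈ Finset.range μ.k, μ.w i * f (μ.φ i) j := by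
  classical
  let O : Set (Fin n → ℝ) := {v | ∃ c ∈ convexHull ℝ (Set.range f), ∀ j, v j < K * c j}
  have hOc : Convex ℝ O := by
    rintro x ⟨c, hc, hxc⟩ y ⟨d, hd, hyd⟩ a b ha hb hab
    refine ⟨a • c + b • d, convex_convexHull ℝ _ hc hd ha hb hab, fun j => ?_⟩
    simp only [Pi.add_apply, Pi.smul_apply, smul_eq_mul]
    have h1 := hxc j
    have h2 := hyd j
    rcases ha.eq_or_lt with rfl | ha
    · have : b = 1 := by linarith
      subst this; linarith
    · have := mul_lt_mul_of_pos_left h1 ha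
      have := mul_le_mul_of_nonneg_left h2.le hb
      linarith
  have hOo : IsOpen O := by
    have : O = ⋃ c ∈ convexHull ℝ (Set.range f), {v : Fin n → ℝ | ∀ j, v j < K * c j} := by
      ext v; simp [O]
    rw [this]
    refine isOpen_biUnion fun c _ => ?_
    have h2 : {v : Fin n → ℝ | ∀ j, v j < K * c j} = ⋂ j, {v : Fin n → ℝ | v j < K * c j} := by
      ext v; simp
    rw [h2]
    exact isOpen_iInter_of_finite fun j => isOpen_lt (continuous_apply j) continuous_const
  let v : Fin n → ℝ := fun j => if 0 < g j then g j / 2 else -1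
  have hvg : ∀ j, v j < g j := by
    intro j
    simp only [v]; split_ifs with hj
    · linarith
    · linarith [hg j]
  by_cases hv : v ∈ O
  · obtain ⟨c, hc, hvc⟩ := hv
    obtain ⟨μ, hμ⟩ := fm_of_convexHull f c hc
    refine ⟨μ, fun j => ?_⟩
    rw [← hμ j]
    have := hvc j
    by_cases hj : 0 < g j
    · simp only [v, if_pos hj] at this; linarith
    · have h0 : 0 ≤ c j := by
        rw [hμ j]; exact Finset.sum_nonneg fun i _ => mul_nonneg (μ.nonneg i) (hf _ _)
      have : 0 ≤ 2 * K * c j := by positivity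
      linarith
  · exfalso
    obtain ⟨F, hF⟩ := geometric_hahn_banach_open_point hOc hOo hv
    let a : Fin n → ℝ := fun j => F (Pi.single j 1)
    have hFa : ∀ y, F y = ∑ j, a j * y j := by
      intro y
      conv_lhs => rw [← Finset.univ_sum_single y]
      rw [map_sum]
      refine Finset.sum_congr rfl fun j _ => ?_
      have : (Pi.single j (y j) : Fin n → ℝ) = y j • Pi.single j 1 := by
        rw [← Pi.single_smul]; simp
      rw [this, map_smul, smul_eq_mul, mul_comm]
    obtain ⟨φ0⟩ := ‹Nonempty Φ›
    have hmem : ∀ φ, ∀ y : Fin n → ℝ, (∀ j, y j < K * f φ j) → y ∈ O := fun φ y hy =>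
      ⟨f φ, subset_convexHull ℝ _ ⟨φ, rfl⟩, hy⟩
    have ha : ∀ j, 0 ≤ a j := by
      intro j
      by_contra hj
      push Not at hj
      let y0 : Fin n → ℝ := fun _ => -1
      have hy0 : ∀ i, y0 i < K * f φ0 i := fun i => by
        have := mul_nonneg hK.le (hf φ0 i); simp only [y0]; linarith
      let s : ℝ := (|F v| + |F y0|) / (-a j)
      have hs : 0 ≤ s := div_nonneg (by positivity) (by linarith)
      have := hF (y0 - s • Pi.single j 1) (hmem φ0 _ fun i => by
        have := hy0 i
        have h3 : 0 ≤ s * (Pi.single j 1 : Fin n → ℝ) i := by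
          refine mul_nonneg hs ?_
          by_cases hij : i = j
          · subst hij; simp
          · simp [hij]
        simp only [Pi.sub_apply, Pi.smul_apply, smul_eq_mul]; linarith)
      rw [map_sub, map_smul, smul_eq_mul] at this
      have h4 : s * a j = -(|F v| + |F y0|) := by
        have hj0 : a j ≠ 0 := hj.ne
        simp only [s]; rw [div_mul_eq_mul_div, div_eq_iff (neg_ne_zero.2 hj0)]; ring
      change F y0 - s * a j < F v at this
      rw [h4] at this
      linarith [le_abs_self (F v), neg_abs_le (F y0)]
    have hle : ∀ φ, ∑ j, a j * f φ j ≤ (∑ j, a j * v j) / K := by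
      intro φ
      rw [le_div_iff₀ hK]
      refine le_of_forall_pos_le_add fun ε hε => ?_
      let δ := ε / (∑ j, a j + 1)
      have hA : 0 ≤ ∑ j, a j := Finset.sum_nonneg fun j _ => ha j
      have hδ : 0 < δ := by positivity
      have := hF (fun j => K * f φ j - δ) (hmem φ _ fun j => by linarith)
      rw [hFa, hFa] at this
      have e1 : ∑ j, a j * (K * f φ j - δ) = (∑ j, a j * f φ j) * K - (∑ j, a j) * δ := by
        rw [Finset.sum_mul, Finset.sum_mul, ← Finset.sum_sub_distrib]
        exact Finset.sum_congr rfl fun j _ => by ring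
      have e2 : (∑ j, a j) * δ ≤ ε := by
        simp only [δ]
        rw [mul_div_assoc', div_le_iff₀ (by positivity)]
        nlinarith
      linarith
    have h1 := h a ha _ hle
    rw [mul_div_cancel₀ _ hK.ne'] at h1
    have h2 : ∀ j ∈ Finset.univ, a j * (g j - v j) = 0 := by
      rw [← Finset.sum_eq_zero_iff_of_nonneg fun j _ => mul_nonneg (ha j) (by linarith [hvg j])]
      refine le_antisymm ?_ (Finset.sum_nonneg fun j _ => mul_nonneg (ha j) (by linarith [hvg j]))
      simp only [mul_sub, Finset.sum_sub_distrib]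
      linarith
    have h3 : ∀ j, a j = 0 := fun j => by
      rcases mul_eq_zero.1 (h2 j (Finset.mem_univ _)) with h | h
      · exact h
      · linarith [hvg j]
    have := hF (fun j => -1) (hmem φ0 _ fun j => by
      have := mul_nonneg hK.le (hf φ0 j); linarith)
    rw [hFa, hFa] at this
    simp [h3] at this

/-- interpolation -/
lemma interp (p r c : ℝ) (h1r : 1 < r) (hrp : r < p) (hc : 0 < c) :
    ∃ K : ℝ, 0 ≤ K ∧ ∀ (k : ℕ) (w u : ℕ → ℝ) (A z : ℝ), (∀ i, 0 ≤ w i) → (∀ i, 0 ≤ u i) →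
      0 ≤ A → 0 ≤ z → A ^ p = ∑ i ∈ Finset.range k, w i * u i ^ p →
      z ^ r ≤ c * ∑ i ∈ Finset.range k, w i * u i ^ r →
      z ≤ K * (∑ i ∈ Finset.range k, w i * u i) + 1 / 2 * A := by
  have hr0 : 0 < r := by linarith
  have hp0 : 0 < p := by linarith
  -- pointwise constant
  let ε : ℝ := (1 / 2) ^ r / (2 * c)
  have hε : 0 < ε := by positivity
  let V : ℝ := ε ^ (-1 / (p - r))
  have hV : 0 < V := by positivity
  have hVε : V ^ (r - p) = ε := by
    simp only [V]; rw [← Real.rpow_mul hε.le]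
    have : -1 / (p - r) * (r - p) = 1 := by
      have : p - r ≠ 0 := by linarith
      field_simp; ring
    rw [this, Real.rpow_one]
  let L : ℝ := V ^ (r - 1)
  have hL : 0 < L := by positivity
  have pt : ∀ v : ℝ, 0 ≤ v → v ^ r ≤ L * v + ε * v ^ p := by
    intro v hv
    rcases hv.eq_or_lt with rfl | hv
    · rw [Real.zero_rpow hr0.ne', Real.zero_rpow hp0.ne']; simp
    rcases le_total v V with h | h
    · have h1 : v ^ r = v ^ (r - 1) * v := by
        rw [← Real.rpow_add_one hv.ne']; ring_nf
      have h2 : v ^ (r - 1) ≤ L := Real.rpow_le_rpow hv.le h (by linarith)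
      have h3 : 0 ≤ ε * v ^ p := by positivity
      rw [h1]; nlinarith
    · have h1 : v ^ r = v ^ (r - p) * v ^ p := by
        rw [← Real.rpow_add hv]; ring_nf
      have h2 : v ^ (r - p) ≤ ε := by
        rw [← hVε]; exact Real.rpow_le_rpow_of_nonpos hV h (by linarith)
      have h3 : 0 ≤ v ^ p := by positivity
      rw [h1]; nlinarith [mul_pos hL hv]
  let τ : ℝ := ε / L
  have hτ : 0 < τ := by positivity
  let D : ℝ := (c * (L + ε / τ) * (1 / τ) ^ (r - 1)) ^ (1 / r)
  have hD : 0 ≤ D := by positivity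
  refine ⟨D, hD, ?_⟩
  intro k w u A z hw hu hA hz hAp hzr
  set b := ∑ i ∈ Finset.range k, w i * u i with hb
  have hb0 : 0 ≤ b := Finset.sum_nonneg fun i _ => mul_nonneg (hw i) (hu i)
  rcases hA.eq_or_lt with rfl | hA
  · have : ∑ i ∈ Finset.range k, w i * u i ^ r = 0 := by
      rw [Real.zero_rpow hp0.ne', eq_comm, Finset.sum_eq_zero_iff_of_nonneg
        (fun i _ => mul_nonneg (hw i) (Real.rpow_nonneg (hu i) _))] at hAp
      refine Finset.sum_eq_zero fun i hi => ?_
      rcases mul_eq_zero.1 (hAp i hi) with h | h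
      · simp [h]
      · rw [Real.rpow_eq_zero (hu i) hp0.ne'] at h
        rw [h, Real.zero_rpow hr0.ne', mul_zero]
    rw [this, mul_zero] at hzr
    have hz0 : z = 0 := by
      by_contra h
      have : 0 < z ^ r := Real.rpow_pos_of_pos (lt_of_le_of_ne hz (Ne.symm h)) _
      linarith
    rw [hz0]; positivity
  -- summed inequality
  have hs : ∑ i ∈ Finset.range k, w i * u i ^ r ≤ L * b * A ^ (r - 1) + ε * A ^ r := by
    have h1 : ∀ i ∈ Finset.range k, w i * u i ^ r ≤
        (L * A ^ (r - 1)) * (w i * u i) + (ε * A ^ (r - p)) * (w i * u i ^ p) := by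
      intro i _
      have h2 := pt (u i / A) (div_nonneg (hu i) hA.le)
      rw [Real.div_rpow (hu i) hA.le, Real.div_rpow (hu i) hA.le] at h2
      have hAr : 0 < A ^ r := by positivity
      have h3 := mul_le_mul_of_nonneg_left h2 hAr.le
      have e1 : A ^ r * (u i ^ r / A ^ r) = u i ^ r := by field_simp
      have e2 : A ^ r = A ^ (r - 1) * A := by rw [← Real.rpow_add_one hA.ne']; ring_nf
      have e3 : A ^ r = A ^ (r - p) * A ^ p := by rw [← Real.rpow_add hA]; ring_nf
      have e4 : A ^ r * (L * (u i / A) + ε * (u i ^ p / A ^ p)) =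
          L * A ^ (r - 1) * u i + ε * A ^ (r - p) * u i ^ p := by
        rw [mul_add]
        congr 1
        · rw [e2]; field_simp
        · rw [e3]; field_simp
      rw [e1, e4] at h3
      have := mul_le_mul_of_nonneg_left h3 (hw i)
      nlinarith
    refine (Finset.sum_le_sum h1).trans (le_of_eq ?_)
    rw [Finset.sum_add_distrib, ← Finset.mul_sum, ← Finset.mul_sum, ← hAp, ← hb, mul_assoc ε,
      ← Real.rpow_add hA]
    ring_nf
  have hAr : A ^ r = A ^ (r - 1) * A := by rw [← Real.rpow_add_one hA.ne']; ring_nf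
  rcases le_total b (τ * A) with h | h
  · -- small b
    have h1 : z ^ r ≤ (1 / 2 * A) ^ r := by
      rw [Real.mul_rpow (by norm_num) hA.le]
      have h2 : L * b * A ^ (r - 1) ≤ ε * A ^ r := by
        have : L * b ≤ ε * A := by
          calc L * b ≤ L * (τ * A) := by gcongr
            _ = ε * A := by simp only [τ]; field_simp
        rw [hAr]
        have h5 : 0 ≤ A ^ (r - 1) := by positivity
        nlinarith
      have h3 : c * (2 * ε) = (1 / 2) ^ r := by simp only [ε]; field_simp
      calc z ^ r ≤ c * (L * b * A ^ (r - 1) + ε * A ^ r) := hzr.trans (by gcongr)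
        _ ≤ c * (ε * A ^ r + ε * A ^ r) := by gcongr
        _ = (c * (2 * ε)) * A ^ r := by ring
        _ = _ := by rw [h3]
    have h2 : z ≤ 1 / 2 * A := (Real.rpow_le_rpow_iff hz (by positivity) hr0).1 h1
    have : 0 ≤ D * b := by positivity
    linarith
  · -- large b
    have hAb : A ≤ 1 / τ * b := by
      rw [div_mul_eq_mul_div, one_mul, le_div_iff₀ hτ]; linarith
    have h1 : z ^ r ≤ (D * b) ^ r := by
      have hDr : D ^ r = c * (L + ε / τ) * (1 / τ) ^ (r - 1) := by
        simp only [D]; rw [← Real.rpow_mul (by positivity)]; simp [hr0.ne']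
      have hb1 : 0 < b := lt_of_lt_of_le (by positivity) h
      have hbr : b ^ r = b ^ (r - 1) * b := by rw [← Real.rpow_add_one hb1.ne']; ring_nf
      rw [Real.mul_rpow hD hb0, hDr]
      have h5 : A ^ (r - 1) ≤ (1 / τ) ^ (r - 1) * b ^ (r - 1) := by
        rw [← Real.mul_rpow (by positivity) hb0]
        exact Real.rpow_le_rpow hA.le hAb (by linarith)
      calc z ^ r ≤ c * (L * b * A ^ (r - 1) + ε * A ^ r) := hzr.trans (by gcongr)
        _ = c * (L * b + ε * A) * A ^ (r - 1) := by rw [hAr]; ring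
        _ ≤ c * (L * b + ε * (1 / τ * b)) * ((1 / τ) ^ (r - 1) * b ^ (r - 1)) := by gcongr
        _ = _ := by rw [hbr]; ring
    have h2 : z ≤ D * b := (Real.rpow_le_rpow_iff hz (by positivity) hr0).1 h1
    linarith

lemma contraction {T : Type*} (F : T → ℝ) (c : ℝ) (hb : BddAbove (Set.range F))
    (h : ∀ μ, ∃ ν, F μ ≤ c + 1 / 2 * F ν) (μ : T) : F μ ≤ 2 * c := by
  have : Nonempty T := ⟨μ⟩
  have h1 : (⨆ μ, F μ) ≤ c + 1 / 2 * ⨆ μ, F μ := ciSup_le fun μ => by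
    obtain ⟨ν, hν⟩ := h μ
    linarith [le_ciSup hb ν]
  linarith [le_ciSup hb μ]

/-- polarization identity -/
lemma polarization {𝕜 X : Type*} [RCLike 𝕜] [NormedAddCommGroup X] [NormedSpace 𝕜 X] {m : ℕ}
    (T : ContinuousMultilinearMap 𝕜 (fun _ : Fin m => X) 𝕜) (x : Fin m → X) :
    ∑ ε : Fin m → ℤˣ, (∏ i, ((ε i : ℤ) : 𝕜)) * T (fun _ => ∑ j, ((ε j : ℤ) : 𝕜) • x j) =
      2 ^ m * ∑ σ : Equiv.Perm (Fin m), T (fun i => x (σ i)) := by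
  classical
  have h1 : ∀ ε : Fin m → ℤˣ, T (fun _ => ∑ j, ((ε j : ℤ) : 𝕜) • x j) =
      ∑ f : Fin m → Fin m, (∏ i, ((ε (f i) : ℤ) : 𝕜)) * T (fun i => x (f i)) := by
    intro ε
    rw [T.map_sum (fun (_ : Fin m) (j : Fin m) => ((ε j : ℤ) : 𝕜) • x j)]
    refine Finset.sum_congr rfl fun f _ => ?_
    rw [T.map_smul_univ (fun i => ((ε (f i) : ℤ) : 𝕜)) (fun i => x (f i)), smul_eq_mul]
  simp_rw [h1, Finset.mul_sum]
  rw [Finset.sum_comm]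
  have hsq : ∀ u : ℤˣ, ((u : ℤ) : 𝕜) * ((u : ℤ) : 𝕜) = 1 := by
    intro u; rcases Int.units_eq_one_or u with rfl | rfl <;> simp
  have h2 : ∀ f : Fin m → Fin m, ∑ ε : Fin m → ℤˣ, (∏ i, ((ε i : ℤ) : 𝕜)) *
      ((∏ i, ((ε (f i) : ℤ) : 𝕜)) * T (fun i => x (f i))) =
      if Function.Bijective f then 2 ^ m * T (fun i => x (f i)) else 0 := by
    intro f
    split_ifs with hf
    · have : ∀ ε : Fin m → ℤˣ, (∏ i, ((ε i : ℤ) : 𝕜)) *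
          ((∏ i, ((ε (f i) : ℤ) : 𝕜)) * T (fun i => x (f i))) = T (fun i => x (f i)) := by
        intro ε
        rw [hf.prod_comp (fun i => ((ε i : ℤ) : 𝕜)), ← mul_assoc, ← Finset.prod_mul_distrib]
        simp [hsq]
      simp_rw [this]
      simp [Fintype.card_units_int]
    · have hs : ¬ Function.Surjective f := fun h => hf ⟨Finite.injective_iff_surjective.2 h, h⟩
      simp only [Function.Surjective, not_forall, not_exists] at hs
      obtain ⟨k, hk⟩ := hs
      refine Finset.sum_involution (fun ε _ => Function.update ε k (-ε k)) ?_ ?_ ?_ ?_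
      · intro ε _
        have e1 : ∀ i, Function.update ε k (-ε k) (f i) = ε (f i) := fun i => by
          rw [Function.update_of_ne (hk i)]
        simp_rw [e1]
        have e2 : ∏ i, ((Function.update ε k (-ε k) i : ℤ) : 𝕜) = - ∏ i, ((ε i : ℤ) : 𝕜) := by
          rw [← Finset.mul_prod_erase _ _ (Finset.mem_univ k),
            ← Finset.mul_prod_erase Finset.univ (fun i => ((ε i : ℤ) : 𝕜)) (Finset.mem_univ k)]
          rw [Function.update_self, ← neg_mul]
          congr 1
          · simp
          · refine Finset.prod_congr rfl fun i hi => ?_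
            rw [Function.update_of_ne (Finset.ne_of_mem_erase hi)]
        rw [e2]; ring
      · intro ε _ _ h
        have := congrFun h k
        rw [Function.update_self] at this
        rcases Int.units_eq_one_or (ε k) with h | h <;> rw [h] at this <;> revert this <;> decide
      · simp
      · intro ε _
        simp
  rw [Finset.sum_congr rfl fun f _ => h2 f, ← Finset.sum_filter]
  symm
  refine Finset.sum_bij (fun (σ : Equiv.Perm (Fin m)) _ => (σ : Fin m → Fin m)) ?_ ?_ ?_ ?_
  · intro σ _; exact Finset.mem_filter.2 ⟨Finset.mem_univ _, σ.bijective⟩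
  · intro σ _ τ _ h; exact DFunLike.coe_injective h
  · intro f hf
    exact ⟨Equiv.ofBijective f (Finset.mem_filter.1 hf).2, Finset.mem_univ _, rfl⟩
  · intro σ _; rfl

section Aux
variable {𝕜 : Type*} [RCLike 𝕜] {X : Type*} [NormedAddCommGroup X] [NormedSpace 𝕜 X]
variable {Y : Type*} [NormedAddCommGroup Y] [NormedSpace 𝕜 Y] {m : ℕ}

/-- unit ball of scalar polynomials -/
abbrev PB (𝕜 : Type*) [RCLike 𝕜] (X : Type*) [NormedAddCommGroup X] [NormedSpace 𝕜 X] (m : ℕ) :=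
  {q : X → 𝕜 // IsHomogPoly 𝕜 m q ∧ polyNorm q ≤ 1}

instance instNonemptyPB : Nonempty (PB 𝕜 X m) :=
  ⟨⟨fun _ => 0, ⟨0, fun _ => by simp⟩, by simp [polyNorm]⟩⟩

lemma pb_bound (hm : 0 < m) (q : PB 𝕜 X m) (x : X) : ‖q.1 x‖ ≤ ‖x‖ ^ m := by
  obtain ⟨q, ⟨T, hT⟩, hq⟩ := q
  simp only
  have hne : Nonempty (Fin m) := ⟨⟨0, hm⟩⟩
  have hball : ∀ e : X, ‖e‖ ≤ 1 → ‖q e‖ ≤ 1 := by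
    intro e he
    refine le_trans (le_ciSup (f := fun x : {x : X // ‖x‖ ≤ 1} => ‖q x.1‖) ?_ ⟨e, he⟩) hq
    refine ⟨‖T‖, ?_⟩
    rintro _ ⟨⟨y, hy⟩, rfl⟩
    simp only [hT]
    refine (T.le_opNorm _).trans ?_
    refine mul_le_of_le_one_right (norm_nonneg _) ?_
    exact Finset.prod_le_one (fun _ _ => norm_nonneg _) (fun _ _ => hy)
  by_cases hx : x = 0
  · subst hx
    rw [hT]
    have : T (fun _ => (0 : X)) = 0 := T.map_zero
    rw [this]; simp
  · have hx' : ‖x‖ ≠ 0 := norm_ne_zero_iff.2 hx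
    have h1 : x = ((‖x‖ : ℝ) : 𝕜) • (((‖x‖⁻¹ : ℝ) : 𝕜) • x) := by
      rw [smul_smul, ← RCLike.ofReal_mul, mul_inv_cancel₀ hx']; simp
    have h2 : q x = ((‖x‖ : ℝ) : 𝕜) ^ m * q (((‖x‖⁻¹ : ℝ) : 𝕜) • x) := by
      conv_lhs => rw [h1]
      rw [hT, hT, T.map_smul_univ (fun _ => ((‖x‖ : ℝ) : 𝕜)) (fun _ => ((‖x‖⁻¹ : ℝ) : 𝕜) • x)]
      simp
    rw [h2, norm_mul, norm_pow]
    have h3 := hball (((‖x‖⁻¹ : ℝ) : 𝕜) • x) (by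
      rw [norm_smul]; simp [hx'])
    have h4 : ‖((‖x‖ : ℝ) : 𝕜)‖ = ‖x‖ := by simp
    rw [h4]
    exact mul_le_of_le_one_right (by positivity) h3

lemma pb_exists_T (hm : 0 < m) (q : PB 𝕜 X m) :
    ∃ T : ContinuousMultilinearMap 𝕜 (fun _ : Fin m => X) 𝕜, (∀ x, q.1 x = T (fun _ => x)) ∧
      ∀ x, ‖T x‖ ≤ (m : ℝ) ^ m * ∏ i, ‖x i‖ := by
  classical
  obtain ⟨T, hT⟩ := q.2.1
  let T' : ContinuousMultilinearMap 𝕜 (fun _ : Fin m => X) 𝕜 :=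
    ((m.factorial : 𝕜)⁻¹) • ∑ σ : Equiv.Perm (Fin m), T.domDomCongr σ
  have hT' : ∀ x : Fin m → X, T' x = ((m.factorial : 𝕜)⁻¹) *
      ∑ σ : Equiv.Perm (Fin m), T (fun i => x (σ i)) := by
    intro x
    simp [T']
  have hf : (m.factorial : 𝕜) ≠ 0 := by exact_mod_cast m.factorial_ne_zero
  have hunit : ∀ x : Fin m → X, (∀ i, ‖x i‖ ≤ 1) → ‖T' x‖ ≤ (m : ℝ) ^ m := by
    intro x hx
    have hpol := polarization T x
    have h1 : ‖(2 : 𝕜) ^ m * ∑ σ : Equiv.Perm (Fin m), T (fun i => x (σ i))‖ ≤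
        2 ^ m * (m : ℝ) ^ m := by
      rw [← hpol]
      refine (norm_sum_le _ _).trans ?_
      have : ∀ ε ∈ (Finset.univ : Finset (Fin m → ℤˣ)), ‖(∏ i, ((ε i : ℤ) : 𝕜)) *
          T (fun _ => ∑ j, ((ε j : ℤ) : 𝕜) • x j)‖ ≤ (m : ℝ) ^ m := by
        intro ε _
        have hu : ∀ u : ℤˣ, ‖((u : ℤ) : 𝕜)‖ = 1 := by
          intro u; rcases Int.units_eq_one_or u with rfl | rfl <;> simp
        rw [norm_mul, norm_prod, ← hT]
        simp only [hu, Finset.prod_const_one, one_mul]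
        refine (pb_bound hm q _).trans ?_
        gcongr
        refine (norm_sum_le _ _).trans ?_
        refine (Finset.sum_le_sum (g := fun _ => (1 : ℝ)) fun j _ => ?_).trans (by simp)
        rw [norm_smul, hu, one_mul]; exact hx j
      refine (Finset.sum_le_sum this).trans (by simp [Fintype.card_units_int])
    rw [norm_mul, norm_pow, RCLike.norm_ofNat] at h1
    have h2 := le_of_mul_le_mul_left h1 (by positivity)
    rw [hT', norm_mul]
    refine (mul_le_of_le_one_left (norm_nonneg _) ?_).trans h2
    rw [norm_inv, RCLike.norm_natCast]
    exact inv_le_one_of_one_le₀ (by exact_mod_cast m.factorial_pos)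
  refine ⟨T', fun x => ?_, fun x => ?_⟩
  · rw [hT', hT]
    simp only [Finset.sum_const, Finset.card_univ, Fintype.card_perm, Fintype.card_fin,
      nsmul_eq_mul]
    rw [inv_mul_cancel_left₀ hf]
  · by_cases h0 : ∃ i, x i = 0
    · obtain ⟨i, hi⟩ := h0
      rw [T'.map_coord_zero i hi, norm_zero]
      positivity
    · push Not at h0
      have h1 : x = fun i => ((‖x i‖ : ℝ) : 𝕜) • (((‖x i‖⁻¹ : ℝ) : 𝕜) • x i) := by
        ext i
        rw [smul_smul, ← RCLike.ofReal_mul, mul_inv_cancel₀ (norm_ne_zero_iff.2 (h0 i))]; simp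
      have h2 : T' x = (∏ i, ((‖x i‖ : ℝ) : 𝕜)) • T' (fun i => ((‖x i‖⁻¹ : ℝ) : 𝕜) • x i) := by
        conv_lhs => rw [h1]
        rw [T'.map_smul_univ (fun i => ((‖x i‖ : ℝ) : 𝕜)) (fun i => ((‖x i‖⁻¹ : ℝ) : 𝕜) • x i)]
      rw [h2, norm_smul, norm_prod, mul_comm]
      have h3 := hunit (fun i => ((‖x i‖⁻¹ : ℝ) : 𝕜) • x i) (fun i => by
        rw [norm_smul]; simp [h0 i])
      have h4 : ∀ i, ‖((‖x i‖ : ℝ) : 𝕜)‖ = ‖x i‖ := fun i => by simp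
      simp only [h4]
      gcongr

/-- test form of the summing inequality -/
def TB (m : ℕ) (s : ℝ) (N : ∀ n : ℕ, (Fin n → 𝕜) → (Fin n → X) → ℝ) (K : ℝ) : Prop :=
  ∀ (m₁ m₂ : ℕ) (x : Fin m₁ → Fin m₂ → X) (lam : Fin m₁ → Fin m₂ → 𝕜) (t : ℝ),
    (∀ q : PB 𝕜 X m, ∑ j, ‖∑ i, lam j i • q.1 (x j i)‖ ^ s ≤ t) →
      ∑ j, N m₂ (lam j) (x j) ^ s ≤ K * t

def NP (P : X → Y) : ∀ n : ℕ, (Fin n → 𝕜) → (Fin n → X) → ℝ :=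
  fun _ lam x => ‖∑ i, lam i • P (x i)‖

noncomputable def NM (p : ℝ) (μ : FM (PB 𝕜 X m)) : ∀ n : ℕ, (Fin n → 𝕜) → (Fin n → X) → ℝ :=
  fun _ lam x => (∑ l ∈ Finset.range μ.k, μ.w l * ‖∑ i, lam i • (μ.φ l).1 (x i)‖ ^ p) ^ (1 / p)

lemma t_nonneg {s t : ℝ} {m₁ m₂ : ℕ} {x : Fin m₁ → Fin m₂ → X} {lam : Fin m₁ → Fin m₂ → 𝕜}
    (h : ∀ q : PB 𝕜 X m, ∑ j, ‖∑ i, lam j i • q.1 (x j i)‖ ^ s ≤ t) : 0 ≤ t := by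
  obtain ⟨q⟩ : Nonempty (PB 𝕜 X m) := inferInstance
  exact le_trans (Finset.sum_nonneg fun j _ => by positivity) (h q)

lemma TB.mono {s : ℝ} {N : ∀ n : ℕ, (Fin n → 𝕜) → (Fin n → X) → ℝ} {K K' : ℝ}
    (h : TB m s N K) (hK : K ≤ K') : TB m s N K' := fun m₁ m₂ x lam t ht =>
  (h m₁ m₂ x lam t ht).trans (mul_le_mul_of_nonneg_right hK (t_nonneg ht))

lemma tb_of_bound {s : ℝ} (hs : 0 < s) {P : X → Y} {C : ℝ}
    (h : FactStronglySummingPolyBound 𝕜 m s P C) : TB m s (NP (𝕜 := 𝕜) P) (C ^ s) := by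
  intro m₁ m₂ x lam t ht
  have ht0 := t_nonneg ht
  have h1 := h.2 m₁ m₂ x lam
  have h2 : (⨆ q : PB 𝕜 X m, (∑ j, ‖∑ i, lam j i • q.1 (x j i)‖ ^ s) ^ (1 / s)) ≤
      t ^ (1 / s) := by
    refine ciSup_le fun q => ?_
    exact Real.rpow_le_rpow (Finset.sum_nonneg fun j _ => by positivity) (ht q) (by positivity)
  have h3 := h1.trans (mul_le_mul_of_nonneg_left h2 h.1)
  have h4 := Real.rpow_le_rpow
    (Real.rpow_nonneg (Finset.sum_nonneg fun j _ => by positivity) _) h3 hs.le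
  rw [← Real.rpow_mul (Finset.sum_nonneg fun j _ => by positivity),
    Real.mul_rpow h.1 (by positivity), ← Real.rpow_mul ht0, one_div_mul_cancel hs.ne',
    Real.rpow_one, Real.rpow_one] at h4
  exact h4

lemma cmb_le (hm : 0 < m) (q : PB 𝕜 X m) {n : ℕ} (lam : Fin n → 𝕜) (x : Fin n → X) :
    ‖∑ i, lam i • q.1 (x i)‖ ≤ ∑ i, ‖lam i‖ * ‖x i‖ ^ m := by
  refine (norm_sum_le _ _).trans (Finset.sum_le_sum fun i _ => ?_)
  rw [norm_smul]
  exact mul_le_mul_of_nonneg_left (pb_bound hm q _) (norm_nonneg _)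

lemma bound_of_tb (hm : 0 < m) {s : ℝ} (hs : 0 < s) {P : X → Y} {K : ℝ} (hK : 0 ≤ K)
    (h : TB m s (NP (𝕜 := 𝕜) P) K) : FactStronglySummingPolyBound 𝕜 m s P (K ^ (1 / s)) := by
  refine ⟨by positivity, fun m₁ m₂ x lam => ?_⟩
  have hbdd : BddAbove (Set.range fun q : PB 𝕜 X m =>
      (∑ j, ‖∑ i, lam j i • q.1 (x j i)‖ ^ s) ^ (1 / s)) := by
    refine ⟨(∑ j, (∑ i, ‖lam j i‖ * ‖x j i‖ ^ m) ^ s) ^ (1 / s), ?_⟩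
    rintro _ ⟨q, rfl⟩
    refine Real.rpow_le_rpow (Finset.sum_nonneg fun j _ => by positivity) ?_ (by positivity)
    exact Finset.sum_le_sum fun j _ => Real.rpow_le_rpow (norm_nonneg _) (cmb_le hm q _ _) hs.le
  set S := ⨆ q : PB 𝕜 X m, (∑ j, ‖∑ i, lam j i • q.1 (x j i)‖ ^ s) ^ (1 / s) with hS
  have hS0 : 0 ≤ S := Real.iSup_nonneg fun q =>
    Real.rpow_nonneg (Finset.sum_nonneg fun j _ => by positivity) _
  have h1 := h m₁ m₂ x lam (S ^ s) (fun q => by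
    have h2 := le_ciSup hbdd q
    have h4 := Real.rpow_le_rpow
      (Real.rpow_nonneg (Finset.sum_nonneg fun j _ => by positivity) _) h2 hs.le
    rwa [← Real.rpow_mul (Finset.sum_nonneg fun j _ => by positivity),
      one_div_mul_cancel hs.ne', Real.rpow_one] at h4)
  have h5 := Real.rpow_le_rpow (z := 1 / s) (Finset.sum_nonneg fun j _ =>
    Real.rpow_nonneg (norm_nonneg _) _) h1 (by positivity)
  rw [Real.mul_rpow hK (by positivity), ← Real.rpow_mul hS0, mul_one_div_cancel hs.ne',
    Real.rpow_one] at h5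
  exact h5

lemma pietsch_tb {s : ℝ} (hs : 0 < s) {N : ∀ n : ℕ, (Fin n → 𝕜) → (Fin n → X) → ℝ} {K : ℝ}
    (hK : 0 < K) (h : TB m s N K) (hN : ∀ n lam x, 0 ≤ N n lam x)
    (hNh : ∀ n lam x (c : ℝ), 0 ≤ c → N n (fun i => (c : 𝕜) * lam i) x = c * N n lam x)
    (m₁ m₂ : ℕ) (x : Fin m₁ → Fin m₂ → X) (lam : Fin m₁ → Fin m₂ → 𝕜) :
    ∃ μ : FM (PB 𝕜 X m), ∀ j, N m₂ (lam j) (x j) ^ s ≤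
      2 * K * ∑ l ∈ Finset.range μ.k, μ.w l * ‖∑ i, lam j i • (μ.φ l).1 (x j i)‖ ^ s := by
  refine pietsch (fun (q : PB 𝕜 X m) j => ‖∑ i, lam j i • q.1 (x j i)‖ ^ s)
    (fun q j => by positivity) (fun j => N m₂ (lam j) (x j) ^ s)
    (fun j => Real.rpow_nonneg (hN _ _ _) _) K hK ?_
  intro a ha t ht
  have key : ∀ j, (a j ^ (1 / s)) ^ s = a j := fun j => by
    rw [← Real.rpow_mul (ha j), one_div_mul_cancel hs.ne', Real.rpow_one]
  have ha' : ∀ j, 0 ≤ a j ^ (1 / s) := fun j => Real.rpow_nonneg (ha j) _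
  have h1 := h m₁ m₂ x (fun j i => ((a j ^ (1 / s) : ℝ) : 𝕜) * lam j i) t (fun q => by
    refine le_trans (le_of_eq (Finset.sum_congr rfl fun j _ => ?_)) (ht q)
    simp only [mul_smul, ← Finset.smul_sum]
    rw [norm_smul, RCLike.norm_ofReal, abs_of_nonneg (ha' j),
      Real.mul_rpow (ha' j) (norm_nonneg _), key])
  refine le_trans (le_of_eq (Finset.sum_congr rfl fun j _ => ?_)) h1
  rw [hNh _ _ _ _ (ha' j), Real.mul_rpow (ha' j) (hN _ _ _), key]

lemma NP_nonneg (P : X → Y) (n : ℕ) (lam : Fin n → 𝕜) (x : Fin n → X) : 0 ≤ NP P n lam x :=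
  norm_nonneg _

lemma NP_smul (P : X → Y) (n : ℕ) (lam : Fin n → 𝕜) (x : Fin n → X) (c : ℝ) (hc : 0 ≤ c) :
    NP P n (fun i => (c : 𝕜) * lam i) x = c * NP P n lam x := by
  simp only [NP, mul_smul, ← Finset.smul_sum]
  rw [norm_smul, RCLike.norm_ofReal, abs_of_nonneg hc]

lemma NM_arg_nonneg (p : ℝ) (μ : FM (PB 𝕜 X m)) (n : ℕ) (lam : Fin n → 𝕜) (x : Fin n → X) :
    0 ≤ ∑ l ∈ Finset.range μ.k, μ.w l * ‖∑ i, lam i • (μ.φ l).1 (x i)‖ ^ p :=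
  Finset.sum_nonneg fun l _ => mul_nonneg (μ.nonneg l) (by positivity)

lemma NM_nonneg (p : ℝ) (μ : FM (PB 𝕜 X m)) (n : ℕ) (lam : Fin n → 𝕜) (x : Fin n → X) :
    0 ≤ NM p μ n lam x := Real.rpow_nonneg (NM_arg_nonneg p μ n lam x) _

lemma NM_rpow {p : ℝ} (hp : 0 < p) (μ : FM (PB 𝕜 X m)) (n : ℕ) (lam : Fin n → 𝕜)
    (x : Fin n → X) : NM p μ n lam x ^ p =
      ∑ l ∈ Finset.range μ.k, μ.w l * ‖∑ i, lam i • (μ.φ l).1 (x i)‖ ^ p := by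
  rw [NM, ← Real.rpow_mul (NM_arg_nonneg p μ n lam x), one_div_mul_cancel hp.ne', Real.rpow_one]

lemma NM_smul {p : ℝ} (hp : 0 < p) (μ : FM (PB 𝕜 X m)) (n : ℕ) (lam : Fin n → 𝕜)
    (x : Fin n → X) (c : ℝ) (hc : 0 ≤ c) :
    NM p μ n (fun i => (c : 𝕜) * lam i) x = c * NM p μ n lam x := by
  rw [← Real.rpow_left_inj (NM_nonneg _ _ _ _ _) (mul_nonneg hc (NM_nonneg _ _ _ _ _)) hp.ne',
    Real.mul_rpow hc (NM_nonneg _ _ _ _ _), NM_rpow hp, NM_rpow hp, Finset.mul_sum]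
  refine Finset.sum_congr rfl fun l _ => ?_
  simp only [mul_smul, ← Finset.smul_sum]
  rw [norm_smul, RCLike.norm_ofReal, abs_of_nonneg hc, Real.mul_rpow hc (norm_nonneg _)]
  ring

lemma NM_le (hm : 0 < m) {p : ℝ} (hp : 0 < p) (μ : FM (PB 𝕜 X m)) (n : ℕ) (lam : Fin n → 𝕜)
    (x : Fin n → X) : NM p μ n lam x ≤ ∑ i, ‖lam i‖ * ‖x i‖ ^ m := by
  have h0 : 0 ≤ ∑ i, ‖lam i‖ * ‖x i‖ ^ m := Finset.sum_nonneg fun i _ => by positivity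
  rw [← Real.rpow_le_rpow_iff (NM_nonneg _ _ _ _ _) h0 hp, NM_rpow hp]
  calc _ ≤ ∑ l ∈ Finset.range μ.k, μ.w l * (∑ i, ‖lam i‖ * ‖x i‖ ^ m) ^ p :=
        Finset.sum_le_sum fun l _ => mul_le_mul_of_nonneg_left
          (Real.rpow_le_rpow (norm_nonneg _) (cmb_le hm _ _ _) hp.le) (μ.nonneg l)
    _ = _ := by rw [← Finset.sum_mul, μ.sum_eq, one_mul]

/-- main extrapolation step -/
lemma extrapolate (hm : 0 < m) {p r : ℝ} (h1r : 1 < r) (hrp : r < p) {K : ℝ} (hK : 0 < K)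
    (hU : ∀ μ : FM (PB 𝕜 X m), TB m r (NM p μ) K) {P : X → Y} {K₀ : ℝ} (hK₀ : 0 < K₀)
    (hP : TB m p (NP (𝕜 := 𝕜) P) K₀) :
    ∃ K', 0 ≤ K' ∧ TB m 1 (NP (𝕜 := 𝕜) P) K' := by
  have hp0 : 0 < p := by linarith
  have hr0 : 0 < r := by linarith
  obtain ⟨D, hD, hint⟩ := interp p r (2 * K) h1r hrp (by positivity)
  refine ⟨(2 * K₀) ^ (1 / p) * (2 * D), by positivity, ?_⟩
  intro m₁ m₂ x lam t ht
  have hc := contraction (fun μ : FM (PB 𝕜 X m) => ∑ j, NM p μ m₂ (lam j) (x j)) (D * t) ?_ ?_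
  · obtain ⟨μ, hμ⟩ := pietsch_tb hp0 hK₀ hP (NP_nonneg P) (NP_smul P) m₁ m₂ x lam
    have h1 : ∀ j, NP P m₂ (lam j) (x j) ≤ (2 * K₀) ^ (1 / p) * NM p μ m₂ (lam j) (x j) := by
      intro j
      have h2 := hμ j
      rw [← NM_rpow hp0] at h2
      rw [← Real.rpow_le_rpow_iff (NP_nonneg _ _ _ _)
        (mul_nonneg (by positivity) (NM_nonneg _ _ _ _ _)) hp0,
        Real.mul_rpow (by positivity) (NM_nonneg _ _ _ _ _), ← Real.rpow_mul (by positivity),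
        one_div_mul_cancel hp0.ne', Real.rpow_one]
      exact h2
    simp only [Real.rpow_one]
    calc ∑ j, NP P m₂ (lam j) (x j) ≤ ∑ j, (2 * K₀) ^ (1 / p) * NM p μ m₂ (lam j) (x j) :=
          Finset.sum_le_sum fun j _ => h1 j
      _ = (2 * K₀) ^ (1 / p) * ∑ j, NM p μ m₂ (lam j) (x j) := by rw [Finset.mul_sum]
      _ ≤ (2 * K₀) ^ (1 / p) * (2 * (D * t)) := mul_le_mul_of_nonneg_left (hc μ) (by positivity)
      _ = _ := by ring
  · refine ⟨∑ j, ∑ i, ‖lam j i‖ * ‖x j i‖ ^ m, ?_⟩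
    rintro _ ⟨μ, rfl⟩
    exact Finset.sum_le_sum fun j _ => NM_le hm hp0 μ _ _ _
  · intro μ
    obtain ⟨ν, hν⟩ := pietsch_tb hr0 hK (hU μ) (NM_nonneg p μ) (NM_smul hp0 μ) m₁ m₂ x lam
    refine ⟨ν, ?_⟩
    have h1 : ∀ j, NM p μ m₂ (lam j) (x j) ≤
        D * (∑ l ∈ Finset.range ν.k, ν.w l * ‖∑ i, lam j i • (ν.φ l).1 (x j i)‖) +
          1 / 2 * NM p ν m₂ (lam j) (x j) := fun j =>
      hint ν.k ν.w (fun l => ‖∑ i, lam j i • (ν.φ l).1 (x j i)‖) _ _ ν.nonneg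
        (fun l => norm_nonneg _) (NM_nonneg _ _ _ _ _) (NM_nonneg _ _ _ _ _)
        (NM_rpow hp0 _ _ _ _) (hν j)
    have h2 : ∑ j, ∑ l ∈ Finset.range ν.k, ν.w l * ‖∑ i, lam j i • (ν.φ l).1 (x j i)‖ ≤ t := by
      rw [Finset.sum_comm]
      calc _ ≤ ∑ l ∈ Finset.range ν.k, ν.w l * t := Finset.sum_le_sum fun l _ => by
            rw [← Finset.mul_sum]
            refine mul_le_mul_of_nonneg_left ?_ (ν.nonneg l)
            simpa only [Real.rpow_one] using ht (ν.φ l)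
        _ = t := by rw [← Finset.sum_mul, ν.sum_eq, one_mul]
    calc _ ≤ ∑ j, (D * (∑ l ∈ Finset.range ν.k, ν.w l * ‖∑ i, lam j i • (ν.φ l).1 (x j i)‖) +
          1 / 2 * NM p ν m₂ (lam j) (x j)) := Finset.sum_le_sum fun j _ => h1 j
      _ ≤ _ := by
        rw [Finset.sum_add_distrib, ← Finset.mul_sum, ← Finset.mul_sum]
        gcongr

/-- inclusion -/
lemma inclusion_tb {p : ℝ} (hp : 1 < p) {P : X → Y} {K : ℝ} (hK : 0 ≤ K)
    (h : TB m 1 (NP (𝕜 := 𝕜) P) K) : TB m p (NP (𝕜 := 𝕜) P) (K ^ p) := by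
  intro m₁ m₂ x lam t ht
  have ht0 := t_nonneg ht
  have hp0 : 0 < p := by linarith
  let a : Fin m₁ → ℝ := fun j => NP P m₂ (lam j) (x j)
  have ha : ∀ j, 0 ≤ a j := fun j => NP_nonneg _ _ _ _
  have hpq : p.HolderConjugate (p / (p - 1)) := Real.HolderConjugate.conjExponent hp
  set q := p / (p - 1) with hq
  let A := ∑ j, a j ^ p
  have hA : 0 ≤ A := Finset.sum_nonneg fun j _ => Real.rpow_nonneg (ha j) _
  have h1 := h m₁ m₂ x (fun j i => ((a j ^ (p - 1) : ℝ) : 𝕜) * lam j i)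
    (t ^ (1 / p) * A ^ (1 / q)) (fun φ => by
      have h2 := Real.inner_le_Lp_mul_Lq Finset.univ
        (fun j => ‖∑ i, lam j i • φ.1 (x j i)‖) (fun j => a j ^ (p - 1)) hpq
      have e1 : ∀ j, |a j ^ (p - 1)| ^ q = a j ^ p := fun j => by
        rw [abs_of_nonneg (Real.rpow_nonneg (ha j) _), ← Real.rpow_mul (ha j), hq]
        congr 1
        have : p - 1 ≠ 0 := by linarith
        field_simp
      simp only [e1, abs_norm] at h2
      have h3 : ∑ j, ‖∑ i, (((a j ^ (p - 1) : ℝ) : 𝕜) * lam j i) • φ.1 (x j i)‖ ^ (1 : ℝ) =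
          ∑ j, ‖∑ i, lam j i • φ.1 (x j i)‖ * a j ^ (p - 1) := by
        refine Finset.sum_congr rfl fun j _ => ?_
        simp only [mul_smul, ← Finset.smul_sum]
        rw [norm_smul, RCLike.norm_ofReal, abs_of_nonneg (Real.rpow_nonneg (ha j) _),
          Real.rpow_one, mul_comm]
      rw [h3]
      refine h2.trans ?_
      refine mul_le_mul_of_nonneg_right ?_ (by positivity)
      exact Real.rpow_le_rpow (Finset.sum_nonneg fun j _ => by positivity) (ht φ) (by positivity))
  have h4 : ∑ j, NP P m₂ (fun i => ((a j ^ (p - 1) : ℝ) : 𝕜) * lam j i) (x j) ^ (1 : ℝ) = A := by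
    refine Finset.sum_congr rfl fun j _ => ?_
    rw [Real.rpow_one, NP_smul _ _ _ _ _ (Real.rpow_nonneg (ha j) _)]
    change a j ^ (p - 1) * a j = a j ^ p
    rcases (ha j).eq_or_lt with h0 | h0
    · rw [← h0, mul_zero, Real.zero_rpow hp0.ne']
    · rw [← Real.rpow_add_one h0.ne']; ring_nf
  rw [h4] at h1
  change A ≤ K ^ p * t
  rcases hA.eq_or_lt with h0 | h0
  · rw [← h0]; positivity
  have e2 : A = A ^ (1 / p) * A ^ (1 / q) := by
    rw [← Real.rpow_add h0, one_div, one_div, hpq.inv_add_inv_eq_one, Real.rpow_one]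
  have h5 : A ^ (1 / p) ≤ K * t ^ (1 / p) := by
    refine le_of_mul_le_mul_right ?_ (Real.rpow_pos_of_pos h0 (1 / q))
    rw [← e2, mul_assoc]; exact h1
  have h6 := Real.rpow_le_rpow (by positivity) h5 hp0.le
  rwa [Real.mul_rpow hK (by positivity), ← Real.rpow_mul hA, ← Real.rpow_mul ht0,
    one_div_mul_cancel hp0.ne', Real.rpow_one, Real.rpow_one] at h6

/-- gluing -/
lemma glue (hm : 0 < m) {p : ℝ} (hp : 1 < p) [Fact ((1 : ℝ≥0∞) ≤ ENNReal.ofReal p)]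
    (W : ℕ → ℝ) (hW : ∀ l, 0 ≤ W l) (hWs : Summable W) (φ : ℕ → PB 𝕜 X m) :
    ∃ P : X → lp (fun _ : ℕ => 𝕜) (ENNReal.ofReal p), IsHomogPoly 𝕜 m P ∧
      ∀ n (lam : Fin n → 𝕜) (x : Fin n → X),
        HasSum (fun l => W l * ‖∑ i, lam i • (φ l).1 (x i)‖ ^ p) (NP P n lam x ^ p) := by
  have hp0 : 0 < p := by linarith
  have hpr : (ENNReal.ofReal p).toReal = p := ENNReal.toReal_ofReal hp0.le
  choose T hT hTb using fun l => pb_exists_T hm (φ l)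
  have hn : ∀ l (z : 𝕜), ‖((W l ^ (1 / p) : ℝ) : 𝕜) * z‖ ^ p = W l * ‖z‖ ^ p := by
    intro l z
    rw [norm_mul, RCLike.norm_ofReal, abs_of_nonneg (Real.rpow_nonneg (hW l) _),
      Real.mul_rpow (Real.rpow_nonneg (hW l) _) (norm_nonneg _), ← Real.rpow_mul (hW l),
      one_div_mul_cancel hp0.ne', Real.rpow_one]
  have hle : ∀ (v : Fin m → X) l, W l * ‖T l v‖ ^ p ≤ W l * ((m : ℝ) ^ m * ∏ i, ‖v i‖) ^ p :=
    fun v l => mul_le_mul_of_nonneg_left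
      (Real.rpow_le_rpow (norm_nonneg _) (hTb l v) hp0.le) (hW l)
  have hsum : ∀ v : Fin m → X, Summable fun l => W l * ‖T l v‖ ^ p := fun v =>
    Summable.of_nonneg_of_le (fun l => mul_nonneg (hW l) (by positivity)) (hle v)
      (hWs.mul_right _)
  have hmem : ∀ v : Fin m → X, Memℓp (fun l => ((W l ^ (1 / p) : ℝ) : 𝕜) * T l v)
      (ENNReal.ofReal p) := fun v => memℓp_gen (by
    rw [hpr]; simp only [hn]; exact hsum v)
  let S : MultilinearMap 𝕜 (fun _ : Fin m => X) (lp (fun _ : ℕ => 𝕜) (ENNReal.ofReal p)) :=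
    { toFun := fun v => ⟨fun l => ((W l ^ (1 / p) : ℝ) : 𝕜) * T l v, hmem v⟩
      map_update_add' := by
        intro _ v i a b
        ext l
        simp only [lp.coeFn_add, Pi.add_apply]
        rw [← mul_add]
        congr 1
        exact (T l).toMultilinearMap.map_update_add' v i a b
      map_update_smul' := by
        intro _ v i c a
        ext l
        simp only [lp.coeFn_smul, Pi.smul_apply, smul_eq_mul]
        rw [mul_left_comm]
        congr 1
        exact (T l).toMultilinearMap.map_update_smul' v i c a }
  have hSl : ∀ v l, (S v : ℕ → 𝕜) l = ((W l ^ (1 / p) : ℝ) : 𝕜) * T l v := fun v l => rfl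
  let B : ℝ := (∑' l, W l) ^ (1 / p) * (m : ℝ) ^ m
  have hW0 : 0 ≤ ∑' l, W l := tsum_nonneg hW
  have hSb : ∀ v, ‖S v‖ ≤ B * ∏ i, ‖v i‖ := by
    intro v
    have hpi : 0 ≤ ∏ i, ‖v i‖ := Finset.prod_nonneg fun i _ => norm_nonneg _
    refine lp.norm_le_of_tsum_le (by rw [hpr]; exact hp0) (by positivity) ?_
    rw [hpr]
    simp only [hSl, hn, B]
    rw [mul_assoc, Real.mul_rpow (by positivity) (by positivity), ← Real.rpow_mul hW0,
      one_div_mul_cancel hp0.ne', Real.rpow_one, ← tsum_mul_right]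
    exact (hsum v).tsum_le_tsum (hle v) (hWs.mul_right _)
  refine ⟨fun x => S (fun _ => x), ⟨S.mkContinuous B hSb, fun x => rfl⟩, ?_⟩
  intro n lam x
  have h1 := lp.hasSum_norm (by rw [hpr]; exact hp0) (∑ i, lam i • S (fun _ => x i))
  rw [hpr] at h1
  have h2 : (fun l => W l * ‖∑ i, lam i • (φ l).1 (x i)‖ ^ p) =
      fun l => ‖(∑ i, lam i • S (fun _ => x i) : lp (fun _ : ℕ => 𝕜) (ENNReal.ofReal p)) l‖ ^ p := by
    funext l
    rw [← hn]
    congr 2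
    rw [lp.coeFn_sum, Finset.sum_apply, Finset.mul_sum]
    refine Finset.sum_congr rfl fun i _ => ?_
    rw [lp.coeFn_smul, Pi.smul_apply, hSl, hT, smul_eq_mul, smul_eq_mul]
    ring
  rw [h2]
  exact h1

/-- uniform constant -/
lemma uniform (hm : 0 < m) {p r : ℝ} (h1r : 1 < r) (hrp : r < p)
    [Fact ((1 : ℝ≥0∞) ≤ ENNReal.ofReal p)]
    (H : ∀ P : X → lp (fun _ : ℕ => 𝕜) (ENNReal.ofReal p), IsHomogPoly 𝕜 m P →
        FactStronglySummingPoly 𝕜 m p P → FactStronglySummingPoly 𝕜 m r P) :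
    ∃ K : ℝ, 0 < K ∧ ∀ μ : FM (PB 𝕜 X m), TB m r (NM p μ) K := by
  have hp0 : 0 < p := by linarith
  have hr0 : 0 < r := by linarith
  by_contra hcon
  push Not at hcon
  -- bad measures
  choose μ hμ using fun n : ℕ => hcon ((4 ^ r) ^ n) (by positivity)
  let V : ℕ × ℕ → ℝ := fun a => (1 / 2) ^ a.1 * if a.2 < (μ a.1).k then (μ a.1).w a.2 else 0
  have hV0 : ∀ a, 0 ≤ V a := fun a => by
    simp only [V]
    refine mul_nonneg (by positivity) ?_
    split_ifs
    · exact (μ a.1).nonneg _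
    · exact le_rfl
  have hinner : ∀ n, HasSum (fun i => V (n, i)) ((1 / 2) ^ n) := by
    intro n
    have h1 : ∑ i ∈ Finset.range (μ n).k, V (n, i) = (1 / 2) ^ n := by
      simp only [V]
      rw [← Finset.mul_sum, Finset.sum_congr rfl (fun i hi => if_pos (Finset.mem_range.1 hi)),
        (μ n).sum_eq, mul_one]
    rw [← h1]
    refine hasSum_sum_of_ne_finset_zero fun i hi => ?_
    simp only [V]
    rw [if_neg (by simpa using hi), mul_zero]
  have hVs : Summable V := by
    rw [summable_prod_of_nonneg hV0]
    refine ⟨fun n => (hinner n).summable, ?_⟩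
    simp only [(hinner _).tsum_eq]
    exact summable_geometric_of_lt_one (by norm_num) (by norm_num)
  let W : ℕ → ℝ := fun l => V (Nat.pairEquiv.symm l)
  let φ : ℕ → PB 𝕜 X m := fun l =>
    (μ (Nat.pairEquiv.symm l).1).φ (Nat.pairEquiv.symm l).2
  have hW0 : ∀ l, 0 ≤ W l := fun l => hV0 _
  have hWs : Summable W := by
    have h := (Equiv.summable_iff (f := V) Nat.pairEquiv.symm).2 hVs
    exact h
  obtain ⟨P, hPh, hP⟩ := glue hm (by linarith) W hW0 hWs φ
  have hPp : TB m p (NP (𝕜 := 𝕜) P) (∑' l, W l) := by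
    intro m₁ m₂ x lam t ht
    have h1 := hasSum_sum (s := Finset.univ) fun j (_ : j ∈ Finset.univ) => hP m₂ (lam j) (x j)
    have h2 : HasSum (fun l => W l * t) ((∑' l, W l) * t) := hWs.hasSum.mul_right t
    have h3 : ∀ l, ∑ j, W l * ‖∑ i, lam j i • (φ l).1 (x j i)‖ ^ p ≤ W l * t := by
      intro l
      rw [← Finset.mul_sum]
      exact mul_le_mul_of_nonneg_left (ht (φ l)) (hW0 l)
    exact hasSum_le h3 h1 h2
  obtain ⟨-, C, hC⟩ := H P hPh ⟨hPh, _, bound_of_tb hm hp0 (tsum_nonneg hW0) hPp⟩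
  have hCr := tb_of_bound hr0 hC
  have hC0 := hC.1
  -- comparison
  have hcomp : ∀ n n' (lam : Fin n' → 𝕜) (x : Fin n' → X),
      NM p (μ n) n' lam x ≤ 2 ^ n * NP P n' lam x := by
    intro n n' lam x
    have hNP := NP_nonneg P n' lam x
    rw [← Real.rpow_le_rpow_iff (NM_nonneg _ _ _ _ _) (by positivity) hp0, NM_rpow hp0,
      Real.mul_rpow (by positivity) hNP]
    have h1 := hP n' lam x
    have h2 : HasSum (fun a : ℕ × ℕ => V a * ‖∑ i, lam i • ((μ a.1).φ a.2).1 (x i)‖ ^ p)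
        (NP P n' lam x ^ p) := (Equiv.hasSum_iff Nat.pairEquiv.symm).1 h1
    have h3 := sum_le_hasSum ((Finset.range (μ n).k).map
      ⟨Prod.mk n, Prod.mk_right_injective n⟩)
      (fun a _ => mul_nonneg (hV0 a) (by positivity)) h2
    rw [Finset.sum_map] at h3
    have h4 : ∑ l ∈ Finset.range (μ n).k, (μ n).w l * ‖∑ i, lam i • ((μ n).φ l).1 (x i)‖ ^ p ≤
        2 ^ n * NP P n' lam x ^ p := by
      have h5 := mul_le_mul_of_nonneg_left h3 (show (0 : ℝ) ≤ 2 ^ n by positivity)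
      rw [Finset.mul_sum] at h5
      refine Eq.trans_le ?_ h5
      refine Finset.sum_congr rfl fun i hi => ?_
      have hVn : V (n, i) = (1 / 2) ^ n * (μ n).w i := by
        simp only [V]; rw [if_pos (Finset.mem_range.1 hi)]
      change _ = 2 ^ n * (V (n, i) * ‖∑ i', lam i' • ((μ n).φ i).1 (x i')‖ ^ p)
      rw [hVn, ← mul_assoc, ← mul_assoc, ← mul_pow]
      norm_num
    refine h4.trans (mul_le_mul_of_nonneg_right ?_ (by positivity))
    exact Real.self_le_rpow_of_one_le (one_le_pow₀ (by norm_num)) (by linarith)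
  obtain ⟨n, hn⟩ := pow_unbounded_of_one_lt C (show (1 : ℝ) < 2 by norm_num)
  apply hμ n
  intro m₁ m₂ x lam t ht
  have ht0 := t_nonneg ht
  have h1 := hCr m₁ m₂ x lam t ht
  calc ∑ j, NM p (μ n) m₂ (lam j) (x j) ^ r
      ≤ ∑ j, ((2 : ℝ) ^ n) ^ r * NP P m₂ (lam j) (x j) ^ r := Finset.sum_le_sum fun j _ => by
        rw [← Real.mul_rpow (by positivity) (NP_nonneg _ _ _ _)]
        exact Real.rpow_le_rpow (NM_nonneg _ _ _ _ _) (hcomp n _ _ _) hr0.le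
    _ = ((2 : ℝ) ^ n) ^ r * ∑ j, NP P m₂ (lam j) (x j) ^ r := by rw [Finset.mul_sum]
    _ ≤ ((2 : ℝ) ^ n) ^ r * (C ^ r * t) := mul_le_mul_of_nonneg_left h1 (by positivity)
    _ ≤ ((2 : ℝ) ^ n) ^ r * (((2 : ℝ) ^ n) ^ r * t) := by gcongr
    _ = _ := by
      rw [← mul_assoc, ← Real.mul_rpow (by positivity) (by positivity), ← mul_pow,
        ← Real.rpow_natCast, ← Real.rpow_natCast, ← Real.rpow_mul (by norm_num),
        ← Real.rpow_mul (by norm_num), mul_comm r]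
      norm_num

end Aux

universe uY

/-- Extrapolation type theorem: if `1 < r < p` and the classes of
factorable strongly `p`-summing and factorable strongly `r`-summing `m`-homogeneous
polynomials from `X` to `ℓ_p` coincide, then for every Banach space `Y` the classes of
factorable strongly `p`-summing and factorable strongly `1`-summing `m`-homogeneous
polynomials from `X` to `Y` coincide. -/
theorem extrapolation_factStronglySummingPoly
    {𝕜 : Type*} [RCLike 𝕜] {X : Type*}
    [NormedAddCommGroup X] [NormedSpace 𝕜 X] [CompleteSpace X]
    (m : ℕ) (hm : 0 < m) (p r : ℝ) (h1r : 1 < r) (hrp : r < p) :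
    haveI : Fact ((1 : ℝ≥0∞) ≤ ENNReal.ofReal p) :=
      ⟨ENNReal.one_le_ofReal.mpr (by linarith)⟩
    ((∀ P : X → lp (fun _ : ℕ => 𝕜) (ENNReal.ofReal p), IsHomogPoly 𝕜 m P →
        (FactStronglySummingPoly 𝕜 m p P ↔ FactStronglySummingPoly 𝕜 m r P)) →
      ∀ (Y : Type uY) [NormedAddCommGroup Y] [NormedSpace 𝕜 Y] [CompleteSpace Y],
        ∀ P : X → Y, IsHomogPoly 𝕜 m P →
          (FactStronglySummingPoly 𝕜 m p P ↔ FactStronglySummingPoly 𝕜 m 1 P)) := by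
  intro H Y _ _ _ P hPh
  have hp0 : 0 < p := by linarith
  haveI : Fact ((1 : ℝ≥0∞) ≤ ENNReal.ofReal p) := ⟨ENNReal.one_le_ofReal.mpr (by linarith)⟩
  constructor
  · rintro ⟨-, C, hC⟩
    obtain ⟨K, hK, hU⟩ := uniform (𝕜 := 𝕜) (X := X) hm h1r hrp
      (fun P hP => (H P hP).1)
    have hC0 := hC.1
    obtain ⟨K', hK', h⟩ := extrapolate hm h1r hrp hK hU (K₀ := C ^ p + 1) (by positivity)
      ((tb_of_bound hp0 hC).mono (by linarith))
    exact ⟨hPh, _, bound_of_tb hm one_pos hK' h⟩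
  · rintro ⟨-, C, hC⟩
    have hC0 := hC.1
    have h := tb_of_bound one_pos hC
    rw [Real.rpow_one] at h
    exact ⟨hPh, _, bound_of_tb hm hp0 (by positivity) (inclusion_tb (by linarith) hC0 h)⟩
end
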